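/- arXiv:2506.12625 — 2 statements merged into one kernel-verified Lean document; each statement's English description precedes it below -/
import Mathlib

section
/- Let S ⊆ ℝ² be finite and in general position and let s, t ∈ S be distinct. If t lies in a negative cone of s, i.e. t ∈ C̄_{s,i} for some i ∈ {1,2,3}, then there is a path from s to t in the TD_{θ₁,θ₂}-Delaunay graph G of S of total length at most C(θ₁,θ₂)·‖s − t‖; in particular d_G(s,t) ≤ C(θ₁,θ₂)·‖s − t‖. -/
noncomputable section

/-- The Euclidean plane. -/
abbrev Pt : Type := EuclideanSpace ℝ (Fin 2)

/-- The scaled translate `r•Δ + w` of a set `Δ`. -/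
def scaledTranslate (Δ : Set Pt) (r : ℝ) (w : Pt) : Set Pt :=
  (fun x => r • x + w) '' Δ

/-- The triangle with corners `τ 0, τ 1, τ 2`. -/
def Tri (τ : Fin 3 → Pt) : Set Pt := convexHull ℝ (Set.range τ)

/-- Adjacency in the `Δ`-Delaunay graph of `S`: distinct `u, v ∈ S` are adjacent exactly
when some scaled translate of `Δ` has `u` and `v` on its boundary and no point of `S`
in its interior. -/
def TDAdj (Δ : Set Pt) (S : Set Pt) (u v : Pt) : Prop :=
  u ∈ S ∧ v ∈ S ∧ u ≠ v ∧
    ∃ r : ℝ, 0 < r ∧ ∃ w : Pt,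
      u ∈ frontier (scaledTranslate Δ r w) ∧
      v ∈ frontier (scaledTranslate Δ r w) ∧
      ∀ x ∈ S, x ∉ interior (scaledTranslate Δ r w)

/-- Length of a polygonal path given as a list of vertices. -/
def pathLength : List Pt → ℝ
  | [] => 0
  | [_] => 0
  | a :: b :: rest => ‖a - b‖ + pathLength (b :: rest)

/-- `P` is a path in the graph with adjacency `Adj` from `a` to `b`. -/
def IsPathFrom (Adj : Pt → Pt → Prop) (a b : Pt) (P : List Pt) : Prop :=
  P ≠ [] ∧ P.head? = some a ∧ P.getLast? = some b ∧ P.Chain' Adj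

/-- Graph distance: infimum of lengths of paths from `u` to `v`. -/
def dG (Adj : Pt → Pt → Prop) (u v : Pt) : ℝ :=
  sInf { L : ℝ | ∃ P : List Pt, IsPathFrom Adj u v P ∧ pathLength P = L }

/-- `S` is in general position: no two points of `S` determine a line parallel to a side
of the triangle with corners `τ 0, τ 1, τ 2`. -/
def GenPos (τ : Fin 3 → Pt) (S : Set Pt) : Prop :=
  ∀ u ∈ S, ∀ v ∈ S, u ≠ v → ∀ i : Fin 3, ∀ c : ℝ, v - u ≠ c • (τ (i + 1) - τ i)

/-- The inner expression in the definition of `C(θ₁,θ₂)`. -/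
def Cexpr (θ : Fin 3 → ℝ) (j : Fin 3) (α : ℝ) : ℝ :=
  Real.sin (θ j - α) / Real.sin (θ (j + 1)) + Real.sin α / Real.sin (θ (j - 1)) +
    min (Real.sin α / Real.sin (θ (j - 1)) + Real.sin (α + θ (j - 1)) / Real.sin (θ (j + 1)))
        (Real.sin (θ j - α) / Real.sin (θ (j + 1)) +
          Real.sin (α + θ (j - 1)) / Real.sin (θ (j - 1)))

/-- `C(θ₁,θ₂)`: the maximum of `Cexpr θ j α` over `j ∈ {1,2,3}` and `α ∈ [0, θⱼ]`. -/
def Cval (θ : Fin 3 → ℝ) : ℝ :=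
  sSup { x : ℝ | ∃ j : Fin 3, ∃ α : ℝ, α ∈ Set.Icc 0 (θ j) ∧ x = Cexpr θ j α }

/-- The positive cone `C_{p,i}`. -/
def posCone (τ : Fin 3 → Pt) (p : Pt) (i : Fin 3) : Set Pt :=
  { q | ∃ s r : ℝ, 0 ≤ s ∧ 0 ≤ r ∧ q = p + s • (τ (i + 1) - τ i) + r • (τ (i - 1) - τ i) }

/-- The negative cone `C̄_{p,i}`. -/
def negCone (τ : Fin 3 → Pt) (p : Pt) (i : Fin 3) : Set Pt :=
  { q | ∃ s r : ℝ, 0 ≤ s ∧ 0 ≤ r ∧ q = p - s • (τ (i + 1) - τ i) - r • (τ (i - 1) - τ i) }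

/-- Vertices reachable from `s` by a path with at most `k` edges. -/
def ReachK (Adj : Pt → Pt → Prop) (k : ℕ) (s : Pt) : Set Pt :=
  { v | ∃ P : List Pt, IsPathFrom Adj s v P ∧ P.length ≤ k + 1 }


lemma perm_sum {M : Type*} [AddCommMonoid M] (g : Fin 3 → M) (j k l : Fin 3) (h1 : j ≠ k)
    (h2 : k ≠ l) (h3 : j ≠ l) : g j + g k + g l = g 0 + g 1 + g 2 := by
  have hu : (Finset.univ : Finset (Fin 3)) = {j, k, l} := by
    revert j k l
    decide
  rw [← Fin.sum_univ_three, hu, Finset.sum_insert (by simp [h1, h3]),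
    Finset.sum_insert (by simp [h2]), Finset.sum_singleton, add_assoc]

/-- Weighted walks: `WP Adj a b L` says there is a walk from `a` to `b` of length `L`. -/
inductive WP (Adj : Pt → Pt → Prop) : Pt → Pt → ℝ → Prop
  | refl (a : Pt) : WP Adj a a 0
  | cons {a v b : Pt} {L : ℝ} (h : Adj a v) (hw : WP Adj v b L) : WP Adj a b (‖a - v‖ + L)

lemma WP.trans {Adj : Pt → Pt → Prop} {a b c : Pt} {L M : ℝ} (h : WP Adj a b L)
    (h' : WP Adj b c M) : WP Adj a c (L + M) := by
  induction h with
  | refl a => simpa using h'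
  | cons h hw ih =>
    have := WP.cons h (ih h')
    rwa [← add_assoc] at this

lemma WP.single {Adj : Pt → Pt → Prop} {a b : Pt} (h : Adj a b) : WP Adj a b ‖a - b‖ := by
  simpa using WP.cons h (WP.refl b)

lemma WP.symm {Adj : Pt → Pt → Prop} (hsymm : ∀ u v, Adj u v → Adj v u) {a b : Pt} {L : ℝ}
    (h : WP Adj a b L) : WP Adj b a L := by
  induction h with
  | refl a => exact WP.refl a
  | @cons a v b L h hw ih =>
    have := ih.trans (WP.single (hsymm _ _ h))
    rwa [norm_sub_rev, add_comm] at this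

lemma WP.toList {Adj : Pt → Pt → Prop} {a b : Pt} {L : ℝ} (h : WP Adj a b L) :
    ∃ Q : List Pt, IsPathFrom Adj a b (a :: Q) ∧ pathLength (a :: Q) = L := by
  induction h with
  | refl a => exact ⟨[], ⟨by simp, by simp, by simp, List.isChain_singleton a⟩, rfl⟩
  | @cons a v b L h hw ih =>
    obtain ⟨Q, ⟨_, _, h3, h4⟩, h5⟩ := ih
    refine ⟨v :: Q, ⟨by simp, by simp, ?_, ?_⟩, ?_⟩
    · simpa using h3
    · exact List.isChain_cons_cons.2 ⟨h, h4⟩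
    · simp [pathLength, h5]

/-- There is a walk of length at most `L`. -/
def PL (Adj : Pt → Pt → Prop) (a b : Pt) (L : ℝ) : Prop := ∃ M ≤ L, WP Adj a b M

lemma PL.trans {Adj : Pt → Pt → Prop} {a b c : Pt} {L M : ℝ} (h : PL Adj a b L)
    (h' : PL Adj b c M) : PL Adj a c (L + M) := by
  obtain ⟨x, hx, h⟩ := h
  obtain ⟨y, hy, h'⟩ := h'
  exact ⟨x + y, by linarith, h.trans h'⟩

lemma PL.mono {Adj : Pt → Pt → Prop} {a b : Pt} {L M : ℝ} (h : PL Adj a b L)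
    (h' : L ≤ M) : PL Adj a b M := by
  obtain ⟨x, hx, h⟩ := h
  exact ⟨x, by linarith, h⟩

lemma PL.symm {Adj : Pt → Pt → Prop} (hsymm : ∀ u v, Adj u v → Adj v u) {a b : Pt} {L : ℝ}
    (h : PL Adj a b L) : PL Adj b a L := by
  obtain ⟨x, hx, h⟩ := h
  exact ⟨x, hx, h.symm hsymm⟩

/-- The combinatorial data used by the routing argument. -/
structure Sys (Adj : Pt → Pt → Prop) (S : Finset Pt) (f : Fin 3 → Pt → ℝ)
    (ℓ : Fin 3 → Fin 3 → ℝ) : Prop where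
  sym : ∀ u v, Adj u v → Adj v u
  lsym : ∀ i j, ℓ i j = ℓ j i
  lnn : ∀ i j, 0 ≤ ℓ i j
  sum : ∀ u, f 0 u + f 1 u + f 2 u = 1
  inj : ∀ k, ∀ u ∈ S, ∀ v ∈ S, f k u = f k v → u = v
  adj : ∀ j k l, j ≠ k → k ≠ l → j ≠ l → ∀ a ∈ S, ∀ v ∈ S, f k a < f k v → f l a < f l v →
    (∀ u ∈ S, f k a < f k u → f l a < f l u → f j u ≤ f j v) → Adj a v
  nrm : ∀ j k l, j ≠ k → k ≠ l → j ≠ l → ∀ a v, f k a < f k v → f l a < f l v →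
    ‖a - v‖ ≤ (f j a - f j v) * ℓ j k + (f l v - f l a) * ℓ k l

lemma Sys.sum' {Adj : Pt → Pt → Prop} {S : Finset Pt} {f : Fin 3 → Pt → ℝ}
    {ℓ : Fin 3 → Fin 3 → ℝ} (H : Sys Adj S f ℓ) (j k l : Fin 3) (h1 : j ≠ k) (h2 : k ≠ l)
    (h3 : j ≠ l) (u : Pt) : f j u + f k u + f l u = 1 := by
  rw [← H.sum u]
  exact perm_sum (fun m => f m u) j k l h1 h2 h3

lemma Sys.closest {Adj : Pt → Pt → Prop} {S : Finset Pt} {f : Fin 3 → Pt → ℝ}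
    {ℓ : Fin 3 → Fin 3 → ℝ} (H : Sys Adj S f ℓ) (j k l : Fin 3) (h1 : j ≠ k) (h2 : k ≠ l)
    (h3 : j ≠ l) (a b : Pt) (ha : a ∈ S) (hb : b ∈ S) (hk : f k a < f k b)
    (hl : f l a < f l b) :
    ∃ v ∈ S, f k a < f k v ∧ f l a < f l v ∧ Adj a v ∧ f j b ≤ f j v ∧
      ∀ u ∈ S, f k a < f k u → f l a < f l u → f j u ≤ f j v := by
  obtain ⟨v, hv, hmax⟩ := Finset.exists_max_image (S.filter fun u => f k a < f k u ∧ f l a < f l u)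
    (f j) ⟨b, by simp [hb, hk, hl]⟩
  simp only [Finset.mem_filter] at hv hmax
  have hm : ∀ u ∈ S, f k a < f k u → f l a < f l u → f j u ≤ f j v :=
    fun u hu h h' => hmax u ⟨hu, h, h'⟩
  exact ⟨v, hv.1, hv.2.1, hv.2.2, H.adj j k l h1 h2 h3 a ha v hv.1 hv.2.1 hv.2.2 hm,
    hm b hb hk hl, hm⟩

/-- Points of `S` in the canonical triangle with apex `a` and `b` on the opposite side. -/
def canon (S : Finset Pt) (f : Fin 3 → Pt → ℝ) (j k l : Fin 3) (a b : Pt) : Finset Pt :=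
  S.filter fun u => f k a ≤ f k u ∧ f l a ≤ f l u ∧ f j b ≤ f j u

/-- If the corner triangle at corner `l` is empty, there is a path bounded by the detour
via corner `k`. -/
lemma Sys.empty {Adj : Pt → Pt → Prop} {S : Finset Pt} {f : Fin 3 → Pt → ℝ}
    {ℓ : Fin 3 → Fin 3 → ℝ} (H : Sys Adj S f ℓ) (n : ℕ) : ∀ (j k l : Fin 3) (_ : j ≠ k)
    (_ : k ≠ l) (_ : j ≠ l) (a b : Pt) (_ : a ∈ S) (_ : b ∈ S) (_ : f k a < f k b)
    (_ : f l a < f l b) (_ : (canon S f j k l a b).card = n)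
    (_ : ∀ u ∈ S, f k a < f k u → f l b < f l u → f j u ≤ f j b),
    PL Adj a b ((f j a - f j b) * ℓ j k + (f l b - f l a) * ℓ k l) := by
  induction n using Nat.strong_induction_on with
  | _ n ih =>
  intro j k l h1 h2 h3 a b ha hb hk hl hn hemp
  obtain ⟨v, hv, hkv, hlv, hadj, hjv, hmax⟩ := H.closest j k l h1 h2 h3 a b ha hb hk hl
  have sa := H.sum' j k l h1 h2 h3 a
  have sb := H.sum' j k l h1 h2 h3 b
  have sv := H.sum' j k l h1 h2 h3 v
  have hN := H.nrm j k l h1 h2 h3 a v hkv hlv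
  have hE : PL Adj a v ((f j a - f j v) * ℓ j k + (f l v - f l a) * ℓ k l) :=
    ⟨_, hN, WP.single hadj⟩
  by_cases hvb : v = b
  · rwa [hvb] at hE
  have hjv' : f j b < f j v := lt_of_le_of_ne hjv fun h => hvb (H.inj j _ hb _ hv h).symm
  have ham : a ∈ canon S f j k l a b := by simp [canon, ha]; linarith
  rcases lt_or_ge (f l b) (f l v) with hc | hc
  · exact absurd (hemp v hv hkv hc) (not_le.2 hjv')
  have hc' : f l v < f l b := lt_of_le_of_ne hc fun h => hvb (H.inj l _ hv _ hb h)
  rcases lt_or_ge (f k b) (f k v) with hd | hd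
  · -- `v` lies on the side of corner `k`
    have hsub : canon S f l k j b v ⊂ canon S f j k l a b := by
      refine (Finset.ssubset_iff_of_subset ?_).2 ⟨a, ham, ?_⟩
      · intro u hu
        simp only [canon, Finset.mem_filter] at hu ⊢
        exact ⟨hu.1, by linarith, by linarith, by linarith⟩
      · simp only [canon, Finset.mem_filter]
        intro h
        linarith
    have := ih _ (hn ▸ Finset.card_lt_card hsub) l k j h2.symm h1.symm h3.symm b v hb hv hd hjv' rfl
      (by
        intro u hu hu1 hu2
        by_contra hcon
        push Not at hcon
        exact absurd (hmax u hu (by linarith) (by linarith)) (not_le.2 hu2))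
    refine (hE.trans (this.symm H.sym)).mono (le_of_eq ?_)
    rw [H.lsym l k, H.lsym k j]
    ring
  · have hd' : f k v < f k b := lt_of_le_of_ne hd fun h => hvb (H.inj k _ hv _ hb h)
    have hsub : canon S f j k l v b ⊂ canon S f j k l a b := by
      refine (Finset.ssubset_iff_of_subset ?_).2 ⟨a, ham, ?_⟩
      · intro u hu
        simp only [canon, Finset.mem_filter] at hu ⊢
        exact ⟨hu.1, by linarith, by linarith, by linarith⟩
      · simp only [canon, Finset.mem_filter]
        intro h
        linarith
    have := ih _ (hn ▸ Finset.card_lt_card hsub) j k l h1 h2 h3 v b hv hb hd' hc' rfl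
      (fun u hu hu1 hu2 => hemp u hu (by linarith) hu2)
    refine (hE.trans this).mono (le_of_eq ?_)
    ring

/-- The general bound: the larger of the two detours. -/
lemma Sys.main {Adj : Pt → Pt → Prop} {S : Finset Pt} {f : Fin 3 → Pt → ℝ}
    {ℓ : Fin 3 → Fin 3 → ℝ} (H : Sys Adj S f ℓ) (j k l : Fin 3) (h1 : j ≠ k)
    (h2 : k ≠ l) (h3 : j ≠ l) (n : ℕ) : ∀ (a b : Pt) (_ : a ∈ S) (_ : b ∈ S) (_ : f k a < f k b)
    (_ : f l a < f l b) (_ : (canon S f j k l a b).card = n),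
    PL Adj a b (max ((f j a - f j b) * ℓ j k + (f l b - f l a) * ℓ k l)
      ((f j a - f j b) * ℓ j l + (f k b - f k a) * ℓ k l)) := by
  induction n using Nat.strong_induction_on with
  | _ n ih =>
  intro a b ha hb hk hl hn
  obtain ⟨v, hv, hkv, hlv, hadj, hjv, hmax⟩ := H.closest j k l h1 h2 h3 a b ha hb hk hl
  have sa := H.sum' j k l h1 h2 h3 a
  have sb := H.sum' j k l h1 h2 h3 b
  have sv := H.sum' j k l h1 h2 h3 v
  have hN := H.nrm j k l h1 h2 h3 a v hkv hlv
  have hN' := H.nrm j l k h3 h2.symm h1 a v hlv hkv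
  rw [H.lsym l k] at hN'
  have hE : PL Adj a v ‖a - v‖ := ⟨_, le_rfl, WP.single hadj⟩
  by_cases hvb : v = b
  · subst hvb
    exact hE.mono (hN.trans (le_max_left _ _))
  have hjv' : f j b < f j v := lt_of_le_of_ne hjv fun h => hvb (H.inj j _ hb _ hv h).symm
  have ham : a ∈ canon S f j k l a b := by simp [canon, ha]; linarith
  rcases lt_or_ge (f l b) (f l v) with hc | hc
  · have := H.empty _ k l j h2 h3.symm h1.symm b v hb hv hc hjv' rfl
      (by
        intro u hu hu1 hu2
        by_contra hcon
        push Not at hcon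
        exact absurd (hmax u hu (by linarith) (by linarith)) (not_le.2 hu2))
    refine ((hE.mono hN').trans (this.symm H.sym)).mono (le_trans (le_of_eq ?_) (le_max_right _ _))
    rw [H.lsym l j]
    ring
  have hc' : f l v < f l b := lt_of_le_of_ne hc fun h => hvb (H.inj l _ hv _ hb h)
  rcases lt_or_ge (f k b) (f k v) with hd | hd
  · have := H.empty _ l k j h2.symm h1.symm h3.symm b v hb hv hd hjv' rfl
      (by
        intro u hu hu1 hu2
        by_contra hcon
        push Not at hcon
        exact absurd (hmax u hu (by linarith) (by linarith)) (not_le.2 hu2))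
    refine ((hE.mono hN).trans (this.symm H.sym)).mono (le_trans (le_of_eq ?_) (le_max_left _ _))
    rw [H.lsym l k, H.lsym k j]
    ring
  · have hd' : f k v < f k b := lt_of_le_of_ne hd fun h => hvb (H.inj k _ hv _ hb h)
    have hsub : canon S f j k l v b ⊂ canon S f j k l a b := by
      refine (Finset.ssubset_iff_of_subset ?_).2 ⟨a, ham, ?_⟩
      · intro u hu
        simp only [canon, Finset.mem_filter] at hu ⊢
        exact ⟨hu.1, by linarith, by linarith, by linarith⟩
      · simp only [canon, Finset.mem_filter]
        intro h
        linarith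
    have := ih _ (hn ▸ Finset.card_lt_card hsub) v b hv hb hd' hc' rfl
    refine (hE.trans this).mono ?_
    rw [← max_add_add_left]
    apply max_le_max
    · linarith
    · linarith

lemma pathLength_nonneg : ∀ P : List Pt, 0 ≤ pathLength P
  | [] => le_rfl
  | [_] => le_rfl
  | a :: b :: rest => add_nonneg (norm_nonneg _) (pathLength_nonneg (b :: rest))

lemma Cexpr_le_Cval (θ : Fin 3 → ℝ) (j : Fin 3) (α : ℝ) (h0 : 0 ≤ α) (h1 : α ≤ θ j) :
    Cexpr θ j α ≤ Cval θ := by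
  refine le_csSup ?_ ⟨j, α, ⟨h0, h1⟩, rfl⟩
  have hc : ∀ j, Continuous (Cexpr θ j) := by
    intro j
    unfold Cexpr
    fun_prop
  have : BddAbove (⋃ j ∈ (Set.univ : Set (Fin 3)), Cexpr θ j '' Set.Icc 0 (θ j)) :=
    (Set.finite_univ.bddAbove_biUnion).2 fun j _ => (isCompact_Icc.image (hc j)).bddAbove
  refine this.mono ?_
  rintro x ⟨j, α, hα, rfl⟩
  simp only [Set.mem_iUnion]
  exact ⟨j, trivial, α, hα, rfl⟩

open EuclideanGeometry in
/-- The trigonometry of a cevian. -/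
lemma cevian (a b X Y : Pt) (A B C : ℝ) (hB : ∠ a X Y = B) (hC : ∠ a Y X = C)
    (hs : Sbtw ℝ X b Y) (haX : a ≠ X) (haY : a ≠ Y)
    (hsum : A + B + C = Real.pi) (hB0 : Real.sin B ≠ 0) (hC0 : Real.sin C ≠ 0) :
    ∃ α, 0 ≤ α ∧ α ≤ A ∧ dist b X = Real.sin (A - α) / Real.sin B * dist a b ∧
      dist b Y = Real.sin α / Real.sin C * dist a b ∧
      dist a X = Real.sin (α + C) / Real.sin B * dist a b ∧
      dist a Y = Real.sin (α + C) / Real.sin C * dist a b := by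
  have e1 : ∠ a Y b = C := by
    rw [← hC, angle_comm, angle_comm a Y X]
    exact (hs.symm.angle_eq_left a)
  have e2 : ∠ a X b = B := by
    rw [← hB, angle_comm, angle_comm a X Y]
    exact (hs.angle_eq_left a)
  have e3 := angle_add_angle_eq_pi_of_angle_eq_pi a hs.angle₁₂₃_eq_pi
  have e4 := angle_add_angle_add_angle_eq_pi (p₁ := a) (p₂ := Y) b haY.symm
  have e5 := angle_add_angle_add_angle_eq_pi (p₁ := a) (p₂ := X) b haX.symm
  rw [e1] at e4
  rw [e2] at e5
  have c1 := angle_comm Y b a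
  have c2 := angle_comm X b a
  have f1 := sin_angle_mul_dist_eq_sin_angle_mul_dist Y a b
  have f2 := sin_angle_mul_dist_eq_sin_angle_mul_dist X a b
  have f3 := sin_angle_mul_dist_eq_sin_angle_mul_dist X b a
  have f4 := sin_angle_mul_dist_eq_sin_angle_mul_dist Y b a
  have hn := angle_nonneg b a X
  have g1 : ∠ b a X = A - ∠ b a Y := by linarith
  have g2 : ∠ X b a = ∠ b a Y + C := by linarith
  have g3 : ∠ Y b a = Real.pi - (∠ b a Y + C) := by linarith
  refine ⟨∠ b a Y, angle_nonneg _ _ _, by linarith, ?_, ?_, ?_, ?_⟩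
  · rw [angle_comm X a b, g1, angle_comm b X a, e2] at f2
    rw [div_mul_eq_mul_div, f2]; field_simp
  · rw [angle_comm Y a b, angle_comm b Y a, e1] at f1
    rw [div_mul_eq_mul_div, f1]; field_simp
  · rw [g2, e2, dist_comm b a] at f3
    rw [div_mul_eq_mul_div, f3]; field_simp
  · rw [g3, Real.sin_pi_sub, e1, dist_comm b a] at f4
    rw [div_mul_eq_mul_div, f4]; field_simp

/-- The coordinate description of the plane relative to the triangle yields a routing system. -/
lemma basis_expand (τ : Fin 3 → Pt) (B : AffineBasis (Fin 3) ℝ Pt) (hB : ∀ i, B i = τ i)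
    (j k l : Fin 3) (h1 : j ≠ k) (h2 : k ≠ l) (h3 : j ≠ l) (u v : Pt) :
    v - u = (B.coord k v - B.coord k u) • (τ k - τ j) +
      (B.coord l v - B.coord l u) • (τ l - τ j) := by
  have key : ∀ v : Pt, v = (1 - B.coord k v - B.coord l v) • τ j + B.coord k v • τ k +
      B.coord l v • τ l := by
    intro v
    have e1 := B.linear_combination_coord_eq_self v
    have e2 := B.sum_coord_apply_eq_one v
    rw [Fin.sum_univ_three] at e1 e2
    simp only [hB] at e1
    have e3 : B.coord j v = 1 - B.coord k v - B.coord l v := by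
      have := perm_sum (fun m => B.coord m v) j k l h1 h2 h3
      linarith
    rw [← e3]
    exact e1.symm.trans (perm_sum (fun m => B.coord m v • τ m) j k l h1 h2 h3).symm
  have := congrArg₂ (fun x y : Pt => x - y) (key v) (key u)
  rw [this]
  module

lemma coord_sub (B : AffineBasis (Fin 3) ℝ Pt) (m : Fin 3) (x y : Pt) :
    B.coord m x - B.coord m y = (B.coord m).linear (x - y) := by
  simpa using ((B.coord m).linearMap_vsub x y).symm

lemma coord_scale (τ : Fin 3 → Pt) (B : AffineBasis (Fin 3) ℝ Pt) (hB : ∀ i, B i = τ i)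
    (j m : Fin 3) (r : ℝ) (a x p : Pt) (h : r • x + (a - r • τ j) = p) :
    B.coord m p - B.coord m a = r * (B.coord m x - if m = j then 1 else 0) := by
  have : p - a = r • (x - τ j) := by rw [← h]; module
  have e : B.coord m (τ j) = if m = j then 1 else 0 := by rw [← hB, B.coord_apply]
  rw [coord_sub, this, map_smul, ← coord_sub, e, smul_eq_mul]

lemma td_adj (τ : Fin 3 → Pt) (B : AffineBasis (Fin 3) ℝ Pt) (hB : ∀ i, B i = τ i)
    (S : Finset Pt) (j k l : Fin 3) (h1 : j ≠ k) (h2 : k ≠ l) (h3 : j ≠ l)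
    (hsum : ∀ u, B.coord j u + B.coord k u + B.coord l u = 1) (a : Pt) (ha : a ∈ S)
    (v : Pt) (hv : v ∈ S) (hk : B.coord k a < B.coord k v) (hl : B.coord l a < B.coord l v)
    (hmax : ∀ u ∈ S, B.coord k a < B.coord k u → B.coord l a < B.coord l u →
      B.coord j u ≤ B.coord j v) : TDAdj (Tri τ) ↑S a v := by
  have hr : 0 < B.coord j a - B.coord j v := by linarith [hsum a, hsum v]
  set r := B.coord j a - B.coord j v with hrdef
  have hrange : Set.range τ = Set.range B := by congr 1; ext1 i; exact (hB i).symm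
  have hperm : ∀ m : Fin 3, m = j ∨ m = k ∨ m = l := by
    clear * - h1 h2 h3
    revert j k l
    decide
  have hint : ∀ p ∈ interior (scaledTranslate (Tri τ) r (a - r • τ j)),
      B.coord k a < B.coord k p ∧ B.coord l a < B.coord l p ∧ B.coord j v < B.coord j p := by
    intro p hp
    have hh : scaledTranslate (Tri τ) r (a - r • τ j) =
      ((Homeomorph.smulOfNeZero r hr.ne').trans (Homeomorph.addRight (a - r • τ j))) '' Tri τ := rfl
    rw [hh, ← Homeomorph.image_interior, Tri, hrange, B.interior_convexHull] at hp
    obtain ⟨x, hx, hxp⟩ := hp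
    have hxp' : r • x + (a - r • τ j) = p := hxp
    have hx' : ∀ i, 0 < B.coord i x := hx
    have ek := coord_scale τ B hB j k r a x p hxp'
    have el := coord_scale τ B hB j l r a x p hxp'
    have ej := coord_scale τ B hB j j r a x p hxp'
    rw [if_neg h1.symm] at ek
    rw [if_neg h3.symm] at el
    rw [if_pos rfl] at ej
    have pk := mul_pos hr (hx' k)
    have pl := mul_pos hr (hx' l)
    have pj := mul_pos hr (hx' j)
    refine ⟨by linarith, by linarith, by linarith⟩
  have hcl : ∀ p, B.coord k a ≤ B.coord k p → B.coord l a ≤ B.coord l p →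
      B.coord j v ≤ B.coord j p → p ∈ scaledTranslate (Tri τ) r (a - r • τ j) := by
    intro p pk pl pj
    have hxp : r • (r⁻¹ • (p - (a - r • τ j))) + (a - r • τ j) = p := by
      rw [smul_inv_smul₀ hr.ne']; abel
    refine ⟨r⁻¹ • (p - (a - r • τ j)), ?_, hxp⟩
    rw [Tri, hrange, B.convexHull_eq_nonneg_coord]
    set x := r⁻¹ • (p - (a - r • τ j))
    have ek := coord_scale τ B hB j k r a x p hxp
    have el := coord_scale τ B hB j l r a x p hxp
    have ej := coord_scale τ B hB j j r a x p hxp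
    rw [if_neg h1.symm] at ek
    rw [if_neg h3.symm] at el
    rw [if_pos rfl] at ej
    intro m
    refine nonneg_of_mul_nonneg_right (a := r) ?_ hr
    rcases hperm m with rfl | rfl | rfl
    · linarith
    · linarith
    · linarith
  refine ⟨ha, hv, ?_, r, hr, a - r • τ j, ⟨subset_closure (hcl a le_rfl le_rfl (by linarith)), ?_⟩,
    ⟨subset_closure (hcl v hk.le hl.le le_rfl), ?_⟩, ?_⟩
  · rintro rfl; exact lt_irrefl _ hk
  · intro h; exact lt_irrefl _ (hint a h).1
  · intro h; exact lt_irrefl _ (hint v h).2.2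
  · intro u hu h
    obtain ⟨q1, q2, q3⟩ := hint u h
    exact absurd (hmax u hu q1 q2) (not_le.2 q3)

lemma td_sys (τ : Fin 3 → Pt) (B : AffineBasis (Fin 3) ℝ Pt) (hB : ∀ i, B i = τ i)
    (S : Finset Pt) (hgp : GenPos τ ↑S) :
    Sys (TDAdj (Tri τ) ↑S) S (fun m => B.coord m) (fun i j => ‖τ i - τ j‖) := by
  have hsum0 : ∀ u, B.coord 0 u + B.coord 1 u + B.coord 2 u = 1 := by
    intro u
    have := B.sum_coord_apply_eq_one u
    rwa [Fin.sum_univ_three] at this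
  have hsum : ∀ j k l : Fin 3, j ≠ k → k ≠ l → j ≠ l → ∀ u,
      B.coord j u + B.coord k u + B.coord l u = 1 := by
    intro j k l h1 h2 h3 u
    rw [← hsum0 u]
    exact perm_sum (fun m => B.coord m u) j k l h1 h2 h3
  refine ⟨?_, fun i j => norm_sub_rev _ _, fun i j => norm_nonneg _, hsum0, ?_, ?_, ?_⟩
  · rintro u v ⟨hu, hv, huv, r, hr, w, h1, h2, h3⟩
    exact ⟨hv, hu, huv.symm, r, hr, w, h2, h1, h3⟩
  · intro k u hu v hv h
    by_contra hne
    have hd : k + 1 ≠ k ∧ k ≠ k + 1 + 1 ∧ k + 1 ≠ k + 1 + 1 := by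
      clear * -
      revert k
      decide
    have e := basis_expand τ B hB (k + 1) k (k + 1 + 1) hd.1 hd.2.1 hd.2.2 u v
    rw [h, sub_self, zero_smul, zero_add] at e
    exact hgp u hu v hv hne (k + 1) _ e
  · intro j k l h1 h2 h3 a ha v hv hk hl hmax
    exact td_adj τ B hB S j k l h1 h2 h3 (hsum j k l h1 h2 h3) a ha v hv hk hl hmax
  · intro j k l h1 h2 h3 a v hk hl
    have e := basis_expand τ B hB j k l h1 h2 h3 v a
    have sa := hsum j k l h1 h2 h3 a
    have sv := hsum j k l h1 h2 h3 v
    have e' : a - v = (B.coord j a - B.coord j v) • (τ j - τ k) +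
        (B.coord l v - B.coord l a) • (τ k - τ l) := by
      rw [e, show B.coord j a = 1 - B.coord k a - B.coord l a by linarith,
        show B.coord j v = 1 - B.coord k v - B.coord l v by linarith]
      module
    rw [e']
    refine (norm_add_le _ _).trans (le_of_eq ?_)
    rw [norm_smul, norm_smul, Real.norm_of_nonneg (by linarith), Real.norm_of_nonneg (by linarith)]

/-- If `t` lies in a negative cone of `s`, then there is a path from `s` to
`t` in the `TD_{θ₁,θ₂}`-Delaunay graph of `S` of length at most `C(θ₁,θ₂)·‖s − t‖`;
in particular `d_G(s,t) ≤ C(θ₁,θ₂)·‖s − t‖`. -/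
theorem negative_cone_routing_bound
    (θ : Fin 3 → ℝ) (hθ0 : 0 < θ 0) (hθ01 : θ 0 ≤ θ 1) (hθ12 : θ 1 ≤ θ 2)
    (hsum : θ 0 + θ 1 + θ 2 = Real.pi)
    (τ : Fin 3 → Pt) (hncol : ¬ Collinear ℝ (Set.range τ))
    (hangle : ∀ j : Fin 3, EuclideanGeometry.angle (τ (j + 1)) (τ j) (τ (j - 1)) = θ j)
    (S : Finset Pt) (hgp : GenPos τ ↑S)
    (s t : Pt) (hs : s ∈ S) (ht : t ∈ S) (hst : s ≠ t)
    (i : Fin 3) (hcone : t ∈ negCone τ s i) :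
    (∃ P : List Pt, IsPathFrom (TDAdj (Tri τ) ↑S) s t P ∧
        pathLength P ≤ Cval θ * ‖s - t‖) ∧
      dG (TDAdj (Tri τ) ↑S) s t ≤ Cval θ * ‖s - t‖ := by
  have hind : AffineIndependent ℝ τ := affineIndependent_iff_not_collinear.2 hncol
  have htop : affineSpan ℝ (Set.range τ) = ⊤ := by
    rw [hind.affineSpan_eq_top_iff_card_eq_finrank_add_one]
    simp
  let B : AffineBasis (Fin 3) ℝ Pt := ⟨τ, hind, htop⟩
  have hB : ∀ i, B i = τ i := fun i => rfl
  have H := td_sys τ B hB S hgp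
  have hd : i ≠ i + 1 ∧ i + 1 ≠ i - 1 ∧ i ≠ i - 1 ∧ i + 1 + 1 = i - 1 ∧ i + 1 - 1 = i ∧
      i - 1 + 1 = i ∧ i - 1 - 1 = i + 1 := by
    clear * -
    revert i
    decide
  obtain ⟨d1, d2, d3, d4, d5, d6, d7⟩ := hd
  obtain ⟨p, q, hp0, hq0, htq⟩ := hcone
  have hst' : s - t = p • (τ (i + 1) - τ i) + q • (τ (i - 1) - τ i) := by rw [htq]; abel
  have hp : 0 < p := by
    refine lt_of_le_of_ne hp0 fun h => ?_
    refine hgp t ht s hs hst.symm (i - 1) (-q) ?_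
    rw [hst', ← h, d6]; module
  have hq : 0 < q := by
    refine lt_of_le_of_ne hq0 fun h => ?_
    refine hgp t ht s hs hst.symm i p ?_
    rw [hst', ← h]; module
  have hcd : ∀ m n, B.coord m (τ n) = if m = n then 1 else 0 := by
    intro m n; rw [← hB, B.coord_apply]
  have hco : ∀ m, B.coord m s - B.coord m t =
      p * ((if m = i + 1 then 1 else 0) - (if m = i then 1 else 0)) +
      q * ((if m = i - 1 then 1 else 0) - (if m = i then 1 else 0)) := by
    intro m
    rw [coord_sub, hst', map_add, map_smul, map_smul, ← coord_sub, ← coord_sub, hcd, hcd, hcd]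
    rfl
  have ck : B.coord (i + 1) s - B.coord (i + 1) t = p := by
    rw [hco, if_pos rfl, if_neg d1.symm, if_neg d2]; ring
  have cl : B.coord (i - 1) s - B.coord (i - 1) t = q := by
    rw [hco, if_neg d2.symm, if_neg d3.symm, if_pos rfl]; ring
  have cj : B.coord i t - B.coord i s = p + q := by
    have := hco i
    rw [if_neg d1, if_pos rfl, if_neg d3] at this
    linarith
  have hmain := H.main i (i + 1) (i - 1) d1 d2 d3 _ t s ht hs (by linarith) (by linarith) rfl
  simp only [ck, cl, cj] at hmain
  have hr : 0 < p + q := by linarith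
  -- trigonometry
  have hpos : ∀ m, 0 < θ m ∧ θ m < Real.pi := by
    intro m
    fin_cases m <;> simp <;> constructor <;> linarith
  have hsin : ∀ m, 0 < Real.sin (θ m) := fun m =>
    Real.sin_pos_of_pos_of_lt_pi (hpos m).1 (hpos m).2
  have hsum' : θ i + θ (i + 1) + θ (i - 1) = Real.pi := by
    rw [← hsum]
    exact perm_sum θ _ _ _ d1 d2 d3
  have a1 := hangle (i + 1)
  have a2 := hangle (i - 1)
  rw [d4, d5] at a1
  rw [d6, d7] at a2
  have hne : ∀ m n, m ≠ n → τ m - τ n ≠ 0 := fun m n h h' => h (hind.injective (sub_eq_zero.1 h'))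
  set X : Pt := t + (p + q) • (τ (i + 1) - τ i) with hX
  set Y : Pt := t + (p + q) • (τ (i - 1) - τ i) with hY
  have v1 : X - s = q • (τ (i + 1) - τ (i - 1)) := by
    rw [show X - s = X - t - (s - t) by abel, hst', hX]; module
  have v2 : s - Y = p • (τ (i + 1) - τ (i - 1)) := by
    rw [show s - Y = (s - t) - (Y - t) by abel, hst', hY]; module
  have v3 : t - X = (p + q) • (τ i - τ (i + 1)) := by rw [hX]; module
  have v4 : t - Y = (p + q) • (τ i - τ (i - 1)) := by rw [hY]; module
  have v5 : Y - X = (p + q) • (τ (i - 1) - τ (i + 1)) := by rw [hX, hY]; module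
  have v6 : X - Y = (p + q) • (τ (i + 1) - τ (i - 1)) := by rw [hX, hY]; module
  have hB' : EuclideanGeometry.angle t X Y = θ (i + 1) := by
    rw [← a1, EuclideanGeometry.angle_comm, EuclideanGeometry.angle, EuclideanGeometry.angle,
      vsub_eq_sub, vsub_eq_sub, v3, v5, InnerProductGeometry.angle_smul_smul hr.ne']
    rfl
  have hC' : EuclideanGeometry.angle t Y X = θ (i - 1) := by
    rw [← a2, EuclideanGeometry.angle, EuclideanGeometry.angle,
      vsub_eq_sub, vsub_eq_sub, v4, v6, InnerProductGeometry.angle_smul_smul hr.ne']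
    rfl
  have hsb : Sbtw ℝ X s Y := by
    refine ⟨⟨q / (p + q), ⟨by positivity, by rw [div_le_one hr]; linarith⟩, ?_⟩, ?_, ?_⟩
    · rw [AffineMap.lineMap_apply, vsub_eq_sub, vadd_eq_add, v5, smul_smul, div_mul_cancel₀ _ hr.ne']
      have : s = X - (X - s) := by abel
      rw [this, v1]; module
    · intro h
      have : X - s = 0 := by rw [h]; abel
      rw [v1] at this
      exact smul_ne_zero hq.ne' (hne _ _ d2) this
    · intro h
      have : s - Y = 0 := by rw [h]; abel
      rw [v2] at this
      exact smul_ne_zero hp.ne' (hne _ _ d2) this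
  have htX : t ≠ X := by
    intro h
    have : t - X = 0 := sub_eq_zero.2 h
    rw [v3] at this
    exact smul_ne_zero hr.ne' (hne _ _ d1) this
  have htY : t ≠ Y := by
    intro h
    have : t - Y = 0 := sub_eq_zero.2 h
    rw [v4] at this
    exact smul_ne_zero hr.ne' (hne _ _ d3) this
  obtain ⟨α, hα0, hα1, g1, g2, g3, g4⟩ := cevian t s X Y (θ i) (θ (i + 1)) (θ (i - 1)) hB' hC' hsb
    htX htY hsum' (hsin _).ne' (hsin _).ne'
  have hn : ∀ c : ℝ, 0 < c → ∀ x : Pt, ‖c • x‖ = c * ‖x‖ := fun c hc x => by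
    rw [norm_smul, Real.norm_of_nonneg hc.le]
  rw [dist_comm s X, dist_eq_norm, v1, hn q hq, dist_comm t s, dist_eq_norm] at g1
  rw [dist_eq_norm, v2, hn p hp, dist_comm t s, dist_eq_norm] at g2
  rw [dist_eq_norm, v3, hn _ hr, dist_comm t s, dist_eq_norm] at g3
  rw [dist_eq_norm, v4, hn _ hr, dist_comm t s, dist_eq_norm] at g4
  have hCe : Cexpr θ i α * ‖s - t‖ =
      q * ‖τ (i + 1) - τ (i - 1)‖ + p * ‖τ (i + 1) - τ (i - 1)‖ +
      min (p * ‖τ (i + 1) - τ (i - 1)‖ + (p + q) * ‖τ i - τ (i + 1)‖)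
        (q * ‖τ (i + 1) - τ (i - 1)‖ + (p + q) * ‖τ i - τ (i - 1)‖) := by
    rw [g1, g2, g3, g4, Cexpr, add_mul, min_mul_of_nonneg _ _ (norm_nonneg _)]
    congr 1
    · ring
    · congr 1 <;> ring
  have hle := mul_le_mul_of_nonneg_right (Cexpr_le_Cval θ i α hα0 hα1) (norm_nonneg (s - t))
  have tr1 := norm_sub_le_norm_sub_add_norm_sub (τ i) (τ (i + 1)) (τ (i - 1))
  have tr2 := norm_sub_le_norm_sub_add_norm_sub (τ i) (τ (i - 1)) (τ (i + 1))
  rw [norm_sub_rev (τ (i - 1)) (τ (i + 1))] at tr2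
  have tr1' := mul_le_mul_of_nonneg_left tr1 hr.le
  have tr2' := mul_le_mul_of_nonneg_left tr2 hr.le
  have hL : 0 ≤ ‖τ (i + 1) - τ (i - 1)‖ := norm_nonneg _
  have hpL := mul_nonneg hp.le hL
  have hqL := mul_nonneg hq.le hL
  have hfin : PL (TDAdj (Tri τ) ↑S) s t (Cval θ * ‖s - t‖) := by
    refine (hmain.symm H.sym).mono (le_trans ?_ hle)
    rw [hCe, ← min_add_add_left]
    refine max_le (le_min ?_ ?_) (le_min ?_ ?_) <;> linarith
  obtain ⟨M, hM, hW⟩ := hfin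
  obtain ⟨Q, hQ, hQL⟩ := hW.toList
  refine ⟨⟨s :: Q, hQ, hQL.trans_le hM⟩, le_trans (csInf_le ?_ ⟨s :: Q, hQ, hQL⟩) hM⟩
  refine ⟨0, ?_⟩
  rintro _ ⟨P, _, rfl⟩
  exact pathLength_nonneg P
end
end

section
/- Fix a positive integer k. Let A : ℝ² × Set (ℝ² × ℝ²) × ℝ² → ℝ² be any function (interpreted as a deterministic memoryless k-local routing algorithm: its arguments are the current vertex p, the set of adjacent pairs among vertices within k edges of p, and the destination t). Then for every ε > 0 there exist a finite set S ⊆ ℝ² in general position and distinct s, t ∈ S such that, in the TD_{θ₁,θ₂}-Delaunay graph G of S, the walk v₀ = s, v_{m+1} = A(vₘ, Eₖ(vₘ), t) — where Eₖ(vₘ) is the set of pairs (u,w) of vertices adjacent in G with both u and w reachable from vₘ by at most k edges — satisfies: either some step v_{m+1} is not adjacent to vₘ in G, or the walk never reaches t, or, letting M be the least index with v_M = t, the walk length ∑_{m=0}^{M−1} ‖v_{m+1} − vₘ‖ is at least (C(θ₁,θ₂) − ε)·‖s − t‖. -/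
noncomputable section

structure Frame (τ : Fin 3 → Pt) (e1 e2 : Pt) (fa fb : Pt →L[ℝ] ℝ) : Prop where
  dec : ∀ x, x = fa x • e1 + fb x • e2
  a1 : fa e1 = 1
  a2 : fa e2 = 0
  b1 : fb e1 = 0
  b2 : fb e2 = 1
  adj : ∀ S u v, TDAdj (Tri τ) S u v ↔ u ∈ S ∧ v ∈ S ∧ u ≠ v ∧ ∀ x ∈ S,
    ¬ (min (fa u) (fa v) < fa x ∧ min (fb u) (fb v) < fb x ∧
      fa x + fb x < max (fa u + fb u) (fa v + fb v))
  gen : ∀ S : Set Pt, (∀ u ∈ S, ∀ v ∈ S, u ≠ v →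
    fa u ≠ fa v ∧ fb u ≠ fb v ∧ fa u + fb u ≠ fa v + fb v) → GenPos τ S

lemma interior_half (f : Pt →L[ℝ] ℝ) (x : Pt) (hx : f x = 1) (c : ℝ) :
    interior {y | c ≤ f y} = {y | c < f y} := by
  have hs : Function.Surjective f := fun r => ⟨r • x, by simp [hx]⟩
  have := (f.isOpenMap hs).preimage_interior_eq_interior_preimage f.continuous (Set.Ici c)
  rw [interior_Ici] at this
  exact this.symm

lemma fin3_cases (j i : Fin 3) : i = j ∨ i = j + 1 ∨ i = j - 1 := by
  revert i j; decide

lemma real_bd (a b c d : ℝ) : (min a b ≤ a ∧ min c d ≤ c ∧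
    -(min a b + min c d + (max (a + c) (b + d) - min a b - min c d)) ≤ -(a + c)) ∧
    ¬ (min a b < a ∧ min c d < c ∧
    -(min a b + min c d + (max (a + c) (b + d) - min a b - min c d)) < -(a + c)) := by
  have h := le_max_left (a + c) (b + d)
  refine ⟨⟨min_le_left _ _, min_le_left _ _, by linarith⟩, ?_⟩
  rintro ⟨h1, h2, h3⟩
  have h1' : b < a := by by_contra! h; rw [min_eq_left h] at h1; exact lt_irrefl _ h1
  have h2' : d < c := by by_contra! h; rw [min_eq_left h] at h2; exact lt_irrefl _ h2
  rw [max_eq_left (by linarith)] at h3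
  linarith

lemma real_bd' (b a d c : ℝ) : (min b a ≤ a ∧ min d c ≤ c ∧
    -(min b a + min d c + (max (b + d) (a + c) - min b a - min d c)) ≤ -(a + c)) ∧
    ¬ (min b a < a ∧ min d c < c ∧
    -(min b a + min d c + (max (b + d) (a + c) - min b a - min d c)) < -(a + c)) := by
  rw [min_comm b a, min_comm d c, max_comm]
  exact real_bd a b c d

lemma scaled_desc (τ : Fin 3 → Pt) (j : Fin 3) (fa fb : Pt →L[ℝ] ℝ)
    (dec : ∀ x, x = fa x • (τ (j + 1) - τ j) + fb x • (τ (j - 1) - τ j))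
    (a1 : fa (τ (j + 1) - τ j) = 1) (a2 : fa (τ (j - 1) - τ j) = 0)
    (b1 : fb (τ (j + 1) - τ j) = 0) (b2 : fb (τ (j - 1) - τ j) = 1)
    (r : ℝ) (hr : 0 < r) (w : Pt) :
    scaledTranslate (Tri τ) r w =
      {x | fa (r • τ j + w) ≤ fa x} ∩ ({x | fb (r • τ j + w) ≤ fb x} ∩
        {x | -(fa (r • τ j + w) + fb (r • τ j + w) + r) ≤ (-(fa + fb)) x}) := by
  have hT : Tri τ = {x | fa (τ j) ≤ fa x ∧ fb (τ j) ≤ fb x ∧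
      fa x + fb x ≤ fa (τ j) + fb (τ j) + 1} := by
    have a1' : fa (τ (j + 1)) = fa (τ j) + 1 := by rw [map_sub] at a1; linarith
    have a2' : fa (τ (j - 1)) = fa (τ j) := by rw [map_sub] at a2; linarith
    have b1' : fb (τ (j + 1)) = fb (τ j) := by rw [map_sub] at b1; linarith
    have b2' : fb (τ (j - 1)) = fb (τ j) + 1 := by rw [map_sub] at b2; linarith
    apply Set.Subset.antisymm
    · apply convexHull_min
      · rintro _ ⟨i, rfl⟩
        rcases fin3_cases j i with rfl | rfl | rfl
        · exact ⟨le_refl _, le_refl _, by linarith⟩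
        · exact ⟨by linarith, by linarith, by linarith⟩
        · exact ⟨by linarith, by linarith, by linarith⟩
      · rintro x ⟨h1, h2, h3⟩ y ⟨h1', h2', h3'⟩ p q hp hq hpq
        obtain rfl : q = 1 - p := by linarith
        refine ⟨?_, ?_, ?_⟩ <;> simp only [map_add, map_smul, smul_eq_mul] <;> nlinarith
    · rintro x ⟨h1, h2, h3⟩
      have hc := convex_convexHull ℝ (Set.range τ)
      have hm : ∀ i, τ i ∈ convexHull ℝ (Set.range τ) :=
        fun i => subset_convexHull ℝ _ ⟨i, rfl⟩
      have := hc.sum_mem (t := Finset.univ)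
        (w := ![1 - (fa x - fa (τ j)) - (fb x - fb (τ j)), fa x - fa (τ j), fb x - fb (τ j)])
        (z := ![τ j, τ (j + 1), τ (j - 1)])
        (by intro i _; fin_cases i <;> simp <;> linarith)
        (by simp only [Fin.sum_univ_three, Matrix.cons_val_zero, Matrix.cons_val_one, Matrix.cons_val]; ring)
        (by intro i _; fin_cases i <;> simp [hm])
      change x ∈ convexHull ℝ (Set.range τ)
      convert this using 1
      have hd := dec (x - τ j)
      simp only [map_sub] at hd
      rw [Fin.sum_univ_three]
      change x = (1 - (fa x - fa (τ j)) - (fb x - fb (τ j))) • τ j + (fa x - fa (τ j)) • τ (j + 1) +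
        (fb x - fb (τ j)) • τ (j - 1)
      rw [sub_eq_iff_eq_add] at hd
      nth_rw 1 [hd]
      module
  ext y
  simp only [scaledTranslate, hT, Set.mem_image, Set.mem_ofPred_eq, Set.mem_inter_iff, map_add,
    map_smul, smul_eq_mul, _root_.neg_apply, _root_.add_apply]
  constructor
  · rintro ⟨x, ⟨h1, h2, h3⟩, rfl⟩
    simp only [map_add, map_smul, smul_eq_mul]
    refine ⟨by nlinarith, by nlinarith, by nlinarith⟩
  · rintro ⟨h1, h2, h3⟩
    refine ⟨r⁻¹ • (y - w), ⟨?_, ?_, ?_⟩, ?_⟩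
    · simp only [map_smul, map_sub, smul_eq_mul]
      rw [le_inv_mul_iff₀ hr]; linarith
    · simp only [map_smul, map_sub, smul_eq_mul]
      rw [le_inv_mul_iff₀ hr]; linarith
    · simp only [map_smul, map_sub, smul_eq_mul]
      rw [← mul_add, inv_mul_le_iff₀ hr]; linarith
    · rw [smul_inv_smul₀ hr.ne']; simp

lemma frame_exists (τ : Fin 3 → Pt) (hncol : ¬ Collinear ℝ (Set.range τ)) (j : Fin 3) :
    ∃ fa fb, Frame τ (τ (j + 1) - τ j) (τ (j - 1) - τ j) fa fb := by
  have hli : LinearIndependent ℝ ![τ (j + 1) - τ j, τ (j - 1) - τ j] := by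
    rw [LinearIndependent.pair_iff]
    intro s t hst
    by_contra hne
    apply hncol
    rw [collinear_iff_of_mem (Set.mem_range_self j)]
    by_cases hs : s = 0
    · have ht : t ≠ 0 := fun h => hne ⟨hs, h⟩
      have h0 : τ (j - 1) - τ j = 0 := by
        rw [hs, zero_smul, zero_add] at hst
        exact (smul_eq_zero.1 hst).resolve_left ht
      refine ⟨τ (j + 1) - τ j, ?_⟩
      rintro _ ⟨i, rfl⟩
      rcases fin3_cases j i with rfl | rfl | rfl
      · exact ⟨0, by simp⟩
      · exact ⟨1, by simp⟩
      · exact ⟨0, by simpa [sub_eq_zero] using h0⟩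
    · have h0 : τ (j + 1) - τ j = (-(t / s)) • (τ (j - 1) - τ j) := by
        have : s • (τ (j + 1) - τ j) = s • ((-(t / s)) • (τ (j - 1) - τ j)) := by
          rw [smul_smul, show s * -(t / s) = -t by field_simp, neg_smul]
          exact eq_neg_of_add_eq_zero_left hst
        exact smul_right_injective _ hs this
      refine ⟨τ (j - 1) - τ j, ?_⟩
      rintro _ ⟨i, rfl⟩
      rcases fin3_cases j i with rfl | rfl | rfl
      · exact ⟨0, by simp⟩
      · exact ⟨-(t / s), by rw [← h0]; simp⟩
      · exact ⟨1, by simp⟩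
  let B := basisOfLinearIndependentOfCardEqFinrank hli (by simp)
  have hB0 : B 0 = τ (j + 1) - τ j := by simp [B]
  have hB1 : B 1 = τ (j - 1) - τ j := by simp [B]
  let fa : Pt →L[ℝ] ℝ := LinearMap.toContinuousLinearMap (B.coord 0)
  let fb : Pt →L[ℝ] ℝ := LinearMap.toContinuousLinearMap (B.coord 1)
  have dec : ∀ x, x = fa x • (τ (j + 1) - τ j) + fb x • (τ (j - 1) - τ j) := by
    intro x
    have := B.sum_repr x
    rw [Fin.sum_univ_two, hB0, hB1] at this
    exact this.symm
  have a1 : fa (τ (j + 1) - τ j) = 1 := by rw [← hB0]; simp [fa]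
  have a2 : fa (τ (j - 1) - τ j) = 0 := by rw [← hB1]; simp [fa]
  have b1 : fb (τ (j + 1) - τ j) = 0 := by rw [← hB0]; simp [fb]
  have b2 : fb (τ (j - 1) - τ j) = 1 := by rw [← hB1]; simp [fb]
  clear_value fa fb
  clear hB0 hB1 B
  have hInter : ∀ r : ℝ, 0 < r → ∀ w : Pt, interior (scaledTranslate (Tri τ) r w) =
      {x | fa (r • τ j + w) < fa x} ∩ ({x | fb (r • τ j + w) < fb x} ∩
        {x | -(fa (r • τ j + w) + fb (r • τ j + w) + r) < (-(fa + fb)) x}) := by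
    intro r hr w
    rw [scaled_desc τ j fa fb dec a1 a2 b1 b2 r hr w, interior_inter, interior_inter,
      interior_half fa _ a1, interior_half fb _ b2,
      interior_half (-(fa + fb)) (-(τ (j + 1) - τ j)) (by
        simp only [_root_.neg_apply, _root_.add_apply, map_neg, a1, b1]
        norm_num)]
  have hcl : ∀ r : ℝ, 0 < r → ∀ w : Pt, IsClosed (scaledTranslate (Tri τ) r w) := by
    intro r hr w
    rw [scaled_desc τ j fa fb dec a1 a2 b1 b2 r hr w]
    refine IsClosed.inter ?_ (IsClosed.inter ?_ ?_) <;>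
    exact isClosed_le continuous_const (ContinuousLinearMap.continuous _)
  refine ⟨fa, fb, dec, a1, a2, b1, b2, ?_, ?_⟩
  · intro S u v
    unfold TDAdj
    constructor
    · rintro ⟨hu, hv, huv, r, hr, w, hfu, hfv, hS⟩
      refine ⟨hu, hv, huv, fun x hx => ?_⟩
      rintro ⟨h1, h2, h3⟩
      apply hS x hx
      rw [(hcl r hr w).frontier_eq, scaled_desc τ j fa fb dec a1 a2 b1 b2 r hr w] at hfu hfv
      obtain ⟨⟨u1, u2, u3⟩, -⟩ := hfu
      obtain ⟨⟨v1, v2, v3⟩, -⟩ := hfv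
      rw [hInter r hr w]
      simp only [Set.mem_ofPred_eq, Set.mem_inter_iff, _root_.neg_apply,
        _root_.add_apply] at u1 u2 u3 v1 v2 v3 ⊢
      refine ⟨lt_of_le_of_lt (le_min u1 v1) h1, lt_of_le_of_lt (le_min u2 v2) h2, ?_⟩
      have := lt_of_lt_of_le h3 (max_le (by linarith : fa u + fb u ≤ _)
        (by linarith : fa v + fb v ≤ (fa (r • τ j + w) + fb (r • τ j + w) + r)))
      linarith
    · rintro ⟨hu, hv, huv, hS⟩
      refine ⟨hu, hv, huv, ?_⟩
      have hne : fa u ≠ fa v ∨ fb u ≠ fb v := by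
        by_contra! h
        apply huv
        rw [dec u, dec v, h.1, h.2]
      set m1 := min (fa u) (fa v) with hm1
      set m2 := min (fb u) (fb v) with hm2
      set m3 := max (fa u + fb u) (fa v + fb v) with hm3
      have hr : 0 < m3 - m1 - m2 := by
        have := min_le_left (fa u) (fa v)
        have := min_le_right (fa u) (fa v)
        have := min_le_left (fb u) (fb v)
        have := min_le_right (fb u) (fb v)
        have := le_max_left (fa u + fb u) (fa v + fb v)
        have := le_max_right (fa u + fb u) (fa v + fb v)
        rcases hne with h | h <;> rcases lt_or_gt_of_ne h with h | h <;> linarith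
      let r := m3 - m1 - m2
      let w : Pt := m1 • (τ (j + 1) - τ j) + m2 • (τ (j - 1) - τ j) - r • τ j
      have hw : r • τ j + w = m1 • (τ (j + 1) - τ j) + m2 • (τ (j - 1) - τ j) := by
        simp [w]
      have hwa : fa (r • τ j + w) = m1 := by rw [hw]; simp only [map_add, map_smul, a1, a2]; simp
      have hwb : fb (r • τ j + w) = m2 := by rw [hw]; simp only [map_add, map_smul, b1, b2]; simp
      refine ⟨r, hr, w, ?_, ?_, ?_⟩
      · rw [(hcl r hr w).frontier_eq, hInter r hr w, scaled_desc τ j fa fb dec a1 a2 b1 b2 r hr w,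
          hwa, hwb]
        simp only [Set.mem_sdiff, Set.mem_ofPred_eq, Set.mem_inter_iff,
          _root_.neg_apply, _root_.add_apply, r]
        exact real_bd _ _ _ _
      · rw [(hcl r hr w).frontier_eq, hInter r hr w, scaled_desc τ j fa fb dec a1 a2 b1 b2 r hr w,
          hwa, hwb]
        simp only [Set.mem_sdiff, Set.mem_ofPred_eq, Set.mem_inter_iff,
          _root_.neg_apply, _root_.add_apply, r]
        exact real_bd' _ _ _ _
      · intro x hx hxi
        rw [hInter r hr w, hwa, hwb] at hxi
        simp only [Set.mem_ofPred_eq, Set.mem_inter_iff,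
          _root_.neg_apply, _root_.add_apply, r] at hxi
        exact hS x hx ⟨hxi.1, hxi.2.1, by linarith [hxi.2.2]⟩
  · intro S hS u hu v hv huv i c hc
    obtain ⟨h1, h2, h3⟩ := hS u hu v hv huv
    have e1 : j + 1 + 1 = j - 1 := by clear * -; revert j; decide
    have e2 : j - 1 + 1 = j := by clear * -; revert j; decide
    have ha : fa v - fa u = c * fa (τ (i + 1) - τ i) := by
      rw [← map_sub, hc, map_smul, smul_eq_mul]
    have hb : fb v - fb u = c * fb (τ (i + 1) - τ i) := by
      rw [← map_sub, hc, map_smul, smul_eq_mul]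
    rcases fin3_cases j i with rfl | rfl | rfl
    · rw [b1] at hb; apply h2; linarith
    · rw [e1] at ha hb
      have : τ (j - 1) - τ (j + 1) = (τ (j - 1) - τ j) - (τ (j + 1) - τ j) := by abel
      rw [this, map_sub, a1, a2] at ha
      rw [this, map_sub, b1, b2] at hb
      apply h3; linarith
    · rw [e2] at ha
      rw [← neg_sub (τ (j - 1)) (τ j), map_neg, a2] at ha
      apply h1; linarith

/-- Coordinates of a chain of points indexed by integers in `[-N, N]`. -/
structure ZChain (N : ℕ) (a b : ℤ → ℝ) : Prop where
  mono_a : ∀ i j : ℤ, -N ≤ i → i < j → j ≤ N → a i < a j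
  anti_b : ∀ i j : ℤ, -N ≤ i → i < j → j ≤ N → b j < b i
  pos_a : ∀ i : ℤ, -N ≤ i → i ≤ N → 0 < a i
  pos_b : ∀ i : ℤ, -N ≤ i → i ≤ N → 0 < b i
  ord : ∀ i j : ℤ, a i + b i < a j + b j ↔ (3 * j + 1).natAbs < (3 * i + 1).natAbs

lemma zchain_exists (N : ℕ) (a0 b0 : ℝ) (ha : 0 < a0) (hb : 0 < b0) (hab : a0 + b0 = 1)
    (η : ℝ) (hη : 0 < η) : ∃ a b, ZChain N a b ∧ a 0 = a0 ∧ b 0 = b0 ∧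
      (∀ i : ℤ, 0 < i → i ≤ N → |a i - 1| ≤ η ∧ |b i| ≤ η) ∧
      (∀ i : ℤ, -N ≤ i → i < 0 → |a i| ≤ η ∧ |b i - 1| ≤ η) := by
  obtain ⟨δ, hδ, hd1, hd2, hd3⟩ : ∃ δ : ℝ, 0 < δ ∧ δ * (10 * (N + 1)) < a0 ∧
      δ * (10 * (N + 1)) < b0 ∧ δ * (10 * (N + 1)) ≤ η := by
    have hK : (0 : ℝ) < 10 * (N + 1) := by positivity
    refine ⟨min (min a0 b0) η / 2 / (10 * (N + 1)), by positivity, ?_, ?_, ?_⟩ <;>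
      rw [div_mul_cancel₀ _ hK.ne']
    · have := min_le_left (min a0 b0) η
      have := min_le_left a0 b0
      linarith
    · have := min_le_left (min a0 b0) η
      have := min_le_right a0 b0
      linarith
    · have := min_le_right (min a0 b0) η
      have : 0 < min (min a0 b0) η := by positivity
      linarith
  have hN : (0 : ℝ) ≤ N := by positivity
  have hN' : 0 ≤ δ * N := by positivity
  let a : ℤ → ℝ := fun i => if 0 < i then 1 - δ * (10 * (N + 1) - 7 * i) else
    if i = 0 then a0 else δ * (10 * (N + 1) + 10 * i)
  let b : ℤ → ℝ := fun i => if 0 < i then δ * (10 * (N + 1) - 10 * i) else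
    if i = 0 then b0 else 1 - δ * (10 * (N + 1) - 2 + 7 * i)
  have ap : ∀ i : ℤ, 0 < i → a i = 1 - δ * (10 * (N + 1) - 7 * i) := fun i hi => by simp [a, hi]
  have an : ∀ i : ℤ, i < 0 → a i = δ * (10 * (N + 1) + 10 * i) := fun i hi => by
    simp [a, hi.ne, hi.not_gt]
  have az : a 0 = a0 := by simp [a]
  have bp : ∀ i : ℤ, 0 < i → b i = δ * (10 * (N + 1) - 10 * i) := fun i hi => by simp [b, hi]
  have bn : ∀ i : ℤ, i < 0 → b i = 1 - δ * (10 * (N + 1) - 2 + 7 * i) := fun i hi => by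
    simp [b, hi.ne, hi.not_gt]
  have bz : b 0 = b0 := by simp [b]
  have hp : ∀ i : ℤ, 0 < i → i ≤ N → δ ≤ δ * i ∧ δ * i ≤ δ * N := by
    intro i h0 h1
    have h0' : (1 : ℝ) ≤ i := by exact_mod_cast h0
    have h1' : (i : ℝ) ≤ N := by exact_mod_cast h1
    exact ⟨by nlinarith, by nlinarith⟩
  have hn : ∀ i : ℤ, -N ≤ i → i < 0 → δ * i ≤ -δ ∧ -(δ * N) ≤ δ * i := by
    intro i h1 h0
    have h0' : (i : ℝ) ≤ -1 := by exact_mod_cast (by omega : i ≤ -1)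
    have h1' : -(N : ℝ) ≤ i := by exact_mod_cast h1
    exact ⟨by nlinarith, by nlinarith⟩
  have hlt : ∀ i j : ℤ, i < j → δ * i < δ * j := by
    intro i j h
    exact mul_lt_mul_of_pos_left (by exact_mod_cast h) hδ
  have hsum : ∀ i : ℤ, a i + b i = 1 - δ * ((((3 * i + 1).natAbs : ℤ) : ℝ) - 1) := by
    intro i
    rcases lt_trichotomy i 0 with h | rfl | h
    · rw [an i h, bn i h, show (((3 * i + 1).natAbs : ℤ)) = -(3 * i + 1) by omega]
      push_cast; ring
    · rw [az, bz]; simp [hab]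
    · rw [ap i h, bp i h, show (((3 * i + 1).natAbs : ℤ)) = (3 * i + 1) by omega]
      push_cast; ring
  refine ⟨a, b, ⟨?_, ?_, ?_, ?_, ?_⟩, az, bz, ?_, ?_⟩
  · intro i j hi hij hj
    have hl := hlt i j hij
    rcases lt_trichotomy i 0 with h | rfl | h
    · have h1 := hn i hi h
      rw [an i h]
      rcases lt_trichotomy j 0 with h' | rfl | h'
      · rw [an j h']; linarith
      · rw [az]; linarith
      · have h2 := hp j h' hj
        rw [ap j h']; linarith
    · have h2 := hp j hij hj
      rw [az, ap j hij]; linarith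
    · rw [ap i h, ap j (h.trans hij)]; linarith
  · intro i j hi hij hj
    have hl := hlt i j hij
    rcases lt_trichotomy i 0 with h | rfl | h
    · have h1 := hn i hi h
      rw [bn i h]
      rcases lt_trichotomy j 0 with h' | rfl | h'
      · rw [bn j h']; linarith
      · rw [bz]; linarith
      · have h2 := hp j h' hj
        rw [bp j h']; linarith
    · have h2 := hp j hij hj
      rw [bz, bp j hij]; linarith
    · rw [bp i h, bp j (h.trans hij)]; linarith
  · intro i hi hj
    rcases lt_trichotomy i 0 with h | rfl | h
    · have h1 := hn i hi h
      rw [an i h]; linarith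
    · rw [az]; exact ha
    · have h1 := hp i h hj
      rw [ap i h]; linarith
  · intro i hi hj
    rcases lt_trichotomy i 0 with h | rfl | h
    · have h1 := hn i hi h
      rw [bn i h]; linarith
    · rw [bz]; exact hb
    · have h1 := hp i h hj
      rw [bp i h]; linarith
  · intro i j
    rw [hsum i, hsum j]
    constructor
    · intro h
      have h2 : ((((3 * j + 1).natAbs : ℤ) : ℝ)) < ((((3 * i + 1).natAbs : ℤ) : ℝ)) := by
        by_contra! hc
        have := mul_le_mul_of_nonneg_left hc hδ.le
        linarith
      exact_mod_cast h2
    · intro h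
      have h2 : ((((3 * j + 1).natAbs : ℤ) : ℝ)) < ((((3 * i + 1).natAbs : ℤ) : ℝ)) := by
        exact_mod_cast h
      have := mul_lt_mul_of_pos_left h2 hδ
      linarith
  · intro i h hi
    have h1 := hp i h hi
    rw [ap i h, bp i h, abs_le, abs_le]
    refine ⟨⟨?_, ?_⟩, ⟨?_, ?_⟩⟩ <;> linarith
  · intro i hi h
    have h1 := hn i hi h
    rw [an i h, bn i h, abs_le, abs_le]
    refine ⟨⟨?_, ?_⟩, ⟨?_, ?_⟩⟩ <;> linarith

def zpt (e1 e2 : Pt) (a b : ℤ → ℝ) (i : ℤ) : Pt := a i • e1 + b i • e2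

open Classical in
def zset (e1 e2 : Pt) (a b : ℤ → ℝ) (lo hi : ℤ) : Finset Pt :=
  insert 0 ((Finset.Icc lo hi).image (zpt e1 e2 a b))

section chain
variable {τ : Fin 3 → Pt} {e1 e2 : Pt} {fa fb : Pt →L[ℝ] ℝ} {N : ℕ} {a b : ℤ → ℝ}

lemma mem_zset {lo hi : ℤ} {x : Pt} : x ∈ (↑(zset e1 e2 a b lo hi) : Set Pt) ↔
    x = 0 ∨ ∃ i, lo ≤ i ∧ i ≤ hi ∧ x = zpt e1 e2 a b i := by
  simp only [zset, Finset.coe_insert, Finset.coe_image, Finset.coe_Icc, Set.mem_insert_iff,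
    Set.mem_image, Set.mem_Icc]
  constructor
  · rintro (h | ⟨i, ⟨h1, h2⟩, h3⟩)
    · exact Or.inl h
    · exact Or.inr ⟨i, h1, h2, h3.symm⟩
  · rintro (h | ⟨i, h1, h2, h3⟩)
    · exact Or.inl h
    · exact Or.inr ⟨i, ⟨h1, h2⟩, h3.symm⟩

lemma fa_z (F : Frame τ e1 e2 fa fb) (i : ℤ) : fa (zpt e1 e2 a b i) = a i := by
  simp [zpt, F.a1, F.a2]

lemma fb_z (F : Frame τ e1 e2 fa fb) (i : ℤ) : fb (zpt e1 e2 a b i) = b i := by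
  simp [zpt, F.b1, F.b2]

/-- Combinatorial adjacency of chain points. -/
def zcond (i j : ℤ) : Prop := i ≠ j ∧ ∀ l : ℤ, (i < l ∧ l < j) ∨ (j < l ∧ l < i) →
  (3 * l + 1).natAbs ≤ (3 * i + 1).natAbs ∧ (3 * l + 1).natAbs ≤ (3 * j + 1).natAbs

lemma zcond_level {i j : ℤ} (h : zcond i j) : j.natAbs ≤ i.natAbs + 1 := by
  by_contra! hc
  rcases lt_or_ge j 0 with hj | hj
  · have := (h.2 (j + 1) (by omega)).1
    omega
  · have := (h.2 (j - 1) (by omega)).1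
    omega

lemma adj_zz (F : Frame τ e1 e2 fa fb) (Z : ZChain N a b) {lo hi : ℤ} (hlo : -N ≤ lo)
    (hhi : hi ≤ N) {i j : ℤ} (i1 : lo ≤ i) (i2 : i ≤ hi) (j1 : lo ≤ j) (j2 : j ≤ hi) :
    TDAdj (Tri τ) ↑(zset e1 e2 a b lo hi) (zpt e1 e2 a b i) (zpt e1 e2 a b j) ↔ zcond i j := by
  rw [F.adj]
  simp only [fa_z F, fb_z F]
  constructor
  · rintro ⟨-, -, hne, h⟩
    refine ⟨fun hij => hne (by rw [hij]), fun l hl => ?_⟩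
    have hx := h (zpt e1 e2 a b l) (mem_zset.2 (Or.inr ⟨l, by omega, by omega, rfl⟩))
    rw [fa_z F, fb_z F] at hx
    have hx1 : min (a i) (a j) < a l := by
      rcases hl with hl | hl
      · exact lt_of_le_of_lt (min_le_left _ _) (Z.mono_a i l (by omega) hl.1 (by omega))
      · exact lt_of_le_of_lt (min_le_right _ _) (Z.mono_a j l (by omega) hl.1 (by omega))
    have hx2 : min (b i) (b j) < b l := by
      rcases hl with hl | hl
      · exact lt_of_le_of_lt (min_le_right _ _) (Z.anti_b l j (by omega) hl.2 (by omega))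
      · exact lt_of_le_of_lt (min_le_left _ _) (Z.anti_b l i (by omega) hl.2 (by omega))
    have hx3 : ¬ (a l + b l < max (a i + b i) (a j + b j)) := fun h3 => hx ⟨hx1, hx2, h3⟩
    rw [lt_max_iff, not_or, Z.ord, Z.ord] at hx3
    omega
  · rintro ⟨hne, h⟩
    refine ⟨mem_zset.2 (Or.inr ⟨i, i1, i2, rfl⟩), mem_zset.2 (Or.inr ⟨j, j1, j2, rfl⟩), ?_, ?_⟩
    · intro hz
      have := congrArg fa hz
      rw [fa_z F, fa_z F] at this
      rcases lt_or_gt_of_ne hne with h' | h'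
      · exact (Z.mono_a i j (by omega) h' (by omega)).ne this
      · exact (Z.mono_a j i (by omega) h' (by omega)).ne this.symm
    · rintro x hx ⟨h1, h2, h3⟩
      rcases mem_zset.1 hx with rfl | ⟨l, l1, l2, rfl⟩
      · rw [map_zero] at h1
        have := lt_min (Z.pos_a i (by omega) (by omega)) (Z.pos_a j (by omega) (by omega))
        linarith
      · rw [fa_z F] at h1 h3
        rw [fb_z F] at h2 h3
        rw [lt_max_iff, Z.ord, Z.ord] at h3
        have hA : ∀ p q : ℤ, lo ≤ p → p ≤ hi → lo ≤ q → q ≤ hi → a p < a q → p < q := by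
          intro p q hp hp' hq hq' hpq
          by_contra! hc
          rcases hc.lt_or_eq with hc | rfl
          · have := Z.mono_a q p (by omega) hc (by omega)
            linarith
          · exact lt_irrefl _ hpq
        have hB : ∀ p q : ℤ, lo ≤ p → p ≤ hi → lo ≤ q → q ≤ hi → b p < b q → q < p := by
          intro p q hp hp' hq hq' hpq
          by_contra! hc
          rcases hc.lt_or_eq with hc | rfl
          · have := Z.anti_b p q (by omega) hc (by omega)
            linarith
          · exact lt_irrefl _ hpq
        have k1 : i < l ∨ j < l := by
          rcases min_lt_iff.1 h1 with h | h
          · exact Or.inl (hA _ _ i1 i2 l1 l2 h)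
          · exact Or.inr (hA _ _ j1 j2 l1 l2 h)
        have k2 : l < i ∨ l < j := by
          rcases min_lt_iff.1 h2 with h | h
          · exact Or.inl (hB _ _ i1 i2 l1 l2 h)
          · exact Or.inr (hB _ _ j1 j2 l1 l2 h)
        have := h l (by omega)
        omega

lemma adj_symm (F : Frame τ e1 e2 fa fb) {S : Set Pt} {u v : Pt}
    (h : TDAdj (Tri τ) S u v) : TDAdj (Tri τ) S v u := by
  obtain ⟨h1, h2, h3, r, hr, w, h4, h5, h6⟩ := h
  exact ⟨h2, h1, h3.symm, r, hr, w, h5, h4, h6⟩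

lemma adj_zt (F : Frame τ e1 e2 fa fb) (Z : ZChain N a b) {lo hi m : ℤ} (hlo : -N ≤ lo)
    (hhi : hi ≤ N) (m1 : lo ≤ m) (m2 : m ≤ hi)
    (hm : ∀ i, lo ≤ i → i ≤ hi → i ≠ m → (3 * i + 1).natAbs < (3 * m + 1).natAbs)
    {i : ℤ} (i1 : lo ≤ i) (i2 : i ≤ hi)
    (h : TDAdj (Tri τ) ↑(zset e1 e2 a b lo hi) (zpt e1 e2 a b i) 0) : i = m := by
  by_contra hne
  rw [F.adj] at h
  refine h.2.2.2 (zpt e1 e2 a b m) (mem_zset.2 (Or.inr ⟨m, m1, m2, rfl⟩)) ?_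
  simp only [fa_z F, fb_z F, map_zero]
  refine ⟨?_, ?_, ?_⟩
  · exact lt_of_le_of_lt (min_le_right _ _) (Z.pos_a m (by omega) (by omega))
  · exact lt_of_le_of_lt (min_le_right _ _) (Z.pos_b m (by omega) (by omega))
  · exact lt_of_lt_of_le ((Z.ord m i).2 (hm i i1 i2 hne)) (le_max_left _ _)

lemma zset_gen (F : Frame τ e1 e2 fa fb) (Z : ZChain N a b) {lo hi : ℤ} (hlo : -N ≤ lo)
    (hhi : hi ≤ N) : GenPos τ (↑(zset e1 e2 a b lo hi) : Set Pt) := by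
  apply F.gen
  intro u hu v hv huv
  rcases mem_zset.1 hu with rfl | ⟨i, i1, i2, rfl⟩ <;>
  rcases mem_zset.1 hv with rfl | ⟨j, j1, j2, rfl⟩
  · exact absurd rfl huv
  · have h1 := Z.pos_a j (by omega) (by omega)
    have h2 := Z.pos_b j (by omega) (by omega)
    simp only [fa_z F, fb_z F, map_zero]
    exact ⟨by linarith, by linarith, by linarith⟩
  · have h1 := Z.pos_a i (by omega) (by omega)
    have h2 := Z.pos_b i (by omega) (by omega)
    simp only [fa_z F, fb_z F, map_zero]
    exact ⟨by linarith, by linarith, by linarith⟩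
  · simp only [fa_z F, fb_z F]
    have hij : i ≠ j := fun h => huv (by rw [h])
    have hs : a i + b i ≠ a j + b j := by
      have : (3 * i + 1).natAbs ≠ (3 * j + 1).natAbs := by omega
      rcases lt_or_gt_of_ne this with h | h
      · exact ((Z.ord j i).2 h).ne'
      · exact ((Z.ord i j).2 h).ne
    rcases lt_or_gt_of_ne hij with h | h
    · exact ⟨(Z.mono_a i j (by omega) h (by omega)).ne,
        (Z.anti_b i j (by omega) h (by omega)).ne', hs⟩
    · exact ⟨(Z.mono_a j i (by omega) h (by omega)).ne',
        (Z.anti_b j i (by omega) h (by omega)).ne, hs⟩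

/-- Short walks from the middle of the chain are the same in both graphs. -/
lemma walk_transfer (F : Frame τ e1 e2 fa fb) (Z : ZChain N a b) {k : ℕ} (hk : k < N)
    {lo hi m lo' hi' : ℤ} (hlo : -N ≤ lo) (hhi : hi ≤ N) (hlo' : -N ≤ lo') (hhi' : hi' ≤ N)
    (klo' : lo' ≤ -k) (khi' : k ≤ hi')
    (m1 : lo ≤ m) (m2 : m ≤ hi) (hmN : m.natAbs = N)
    (hm : ∀ i, lo ≤ i → i ≤ hi → i ≠ m → (3 * i + 1).natAbs < (3 * m + 1).natAbs)
    (P : List Pt) : ∀ i : ℤ, lo ≤ i → i ≤ hi → i.natAbs + P.length ≤ k →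
      List.IsChain (TDAdj (Tri τ) ↑(zset e1 e2 a b lo hi)) (zpt e1 e2 a b i :: P) →
      List.IsChain (TDAdj (Tri τ) ↑(zset e1 e2 a b lo' hi')) (zpt e1 e2 a b i :: P) ∧
      ∀ v, (zpt e1 e2 a b i :: P).getLast? = some v →
        ∃ j : ℤ, lo ≤ j ∧ j ≤ hi ∧ j.natAbs ≤ k ∧ v = zpt e1 e2 a b j := by
  induction P with
  | nil =>
    intro i i1 i2 hl _
    refine ⟨List.isChain_singleton _, fun v hv => ⟨i, i1, i2, by simpa using hl, ?_⟩⟩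
    simpa using hv.symm
  | cons y P ih =>
    intro i i1 i2 hl hc
    rw [List.isChain_cons_cons] at hc
    obtain ⟨hadj, hc⟩ := hc
    rw [List.length_cons] at hl
    rcases mem_zset.1 hadj.2.1 with rfl | ⟨j, j1, j2, rfl⟩
    · have := adj_zt F Z hlo hhi m1 m2 hm i1 i2 hadj
      subst this
      omega
    · have hz := (adj_zz F Z hlo hhi i1 i2 j1 j2).1 hadj
      have hlev := zcond_level hz
      obtain ⟨c1, c2⟩ := ih j j1 j2 (by omega) hc
      refine ⟨List.isChain_cons_cons.2 ⟨?_, c1⟩, fun v hv => c2 v ?_⟩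
      · exact (adj_zz F Z hlo' hhi' (by omega) (by omega) (by omega) (by omega)).2 hz
      · rwa [List.getLast?_cons_cons] at hv

lemma reach_transfer (F : Frame τ e1 e2 fa fb) (Z : ZChain N a b) {k : ℕ} (hk : k < N)
    {lo hi m lo' hi' : ℤ} (hlo : -N ≤ lo) (hhi : hi ≤ N) (hlo' : -N ≤ lo') (hhi' : hi' ≤ N)
    (klo : lo ≤ -k) (khi : k ≤ hi) (klo' : lo' ≤ -k) (khi' : k ≤ hi')
    (m1 : lo ≤ m) (m2 : m ≤ hi) (hmN : m.natAbs = N)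
    (hm : ∀ i, lo ≤ i → i ≤ hi → i ≠ m → (3 * i + 1).natAbs < (3 * m + 1).natAbs) {v : Pt}
    (hv : v ∈ ReachK (TDAdj (Tri τ) ↑(zset e1 e2 a b lo hi)) k (zpt e1 e2 a b 0)) :
    v ∈ ReachK (TDAdj (Tri τ) ↑(zset e1 e2 a b lo' hi')) k (zpt e1 e2 a b 0) ∧
      ∃ j : ℤ, lo ≤ j ∧ j ≤ hi ∧ j.natAbs ≤ k ∧ v = zpt e1 e2 a b j := by
  obtain ⟨P, ⟨h1, h2, h3, h4⟩, h5⟩ := hv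
  cases P with
  | nil => exact absurd rfl h1
  | cons y P =>
    simp only [List.head?_cons, Option.some.injEq] at h2
    subst h2
    obtain ⟨c1, c2⟩ := walk_transfer F Z hk hlo hhi hlo' hhi' klo' khi' m1 m2 hmN hm P 0
      (by omega) (by omega) (by simpa using h5) h4
    exact ⟨⟨_, ⟨h1, rfl, h3, c1⟩, h5⟩, c2 v h3⟩

def Ek (τ : Fin 3 → Pt) (S : Set Pt) (k : ℕ) (p : Pt) : Set (Pt × Pt) :=
  { e : Pt × Pt | TDAdj (Tri τ) S e.1 e.2 ∧
    e.1 ∈ ReachK (TDAdj (Tri τ) S) k p ∧ e.2 ∈ ReachK (TDAdj (Tri τ) S) k p }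

lemma Ek_transfer (F : Frame τ e1 e2 fa fb) (Z : ZChain N a b) {k : ℕ} (hk : k < N)
    {lo hi m lo' hi' : ℤ} (hlo : -N ≤ lo) (hhi : hi ≤ N) (hlo' : -N ≤ lo') (hhi' : hi' ≤ N)
    (klo : lo ≤ -k) (khi : k ≤ hi) (klo' : lo' ≤ -k) (khi' : k ≤ hi')
    (m1 : lo ≤ m) (m2 : m ≤ hi) (hmN : m.natAbs = N)
    (hm : ∀ i, lo ≤ i → i ≤ hi → i ≠ m → (3 * i + 1).natAbs < (3 * m + 1).natAbs) :
    Ek τ ↑(zset e1 e2 a b lo hi) k (zpt e1 e2 a b 0) ⊆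
      Ek τ ↑(zset e1 e2 a b lo' hi') k (zpt e1 e2 a b 0) := by
  rintro ⟨u, v⟩ ⟨h1, h2, h3⟩
  obtain ⟨r1, i, i1, i2, i3, rfl : u = _⟩ :=
    reach_transfer F Z hk hlo hhi hlo' hhi' klo khi klo' khi' m1 m2 hmN hm h2
  obtain ⟨r2, j, j1, j2, j3, rfl : v = _⟩ :=
    reach_transfer F Z hk hlo hhi hlo' hhi' klo khi klo' khi' m1 m2 hmN hm h3
  refine ⟨?_, r1, r2⟩
  have h1 := (adj_zz F Z hlo hhi i1 i2 j1 j2).1 h1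
  exact (adj_zz F Z hlo' hhi' (by omega) (by omega) (by omega) (by omega)).2 h1

end chain

section route
variable {τ : Fin 3 → Pt} {e1 e2 : Pt} {fa fb : Pt →L[ℝ] ℝ} {N : ℕ} {a b : ℤ → ℝ}

lemma sum_three (v : ℕ → Pt) (M : ℕ) :
    ‖v 1 - v 0‖ + ‖v (M + 1) - v 1‖ + ‖v (M + 2) - v (M + 1)‖ ≤
      ∑ m ∈ Finset.range (M + 2), ‖v (m + 1) - v m‖ := by
  rw [Finset.sum_range_succ, Finset.sum_range_succ']
  have h := dist_le_range_sum_dist (fun n => v (n + 1)) M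
  simp only [dist_eq_norm'] at h
  linarith

lemma route (F : Frame τ e1 e2 fa fb) (Z : ZChain N a b) (hN : 0 < N)
    {lo hi m : ℤ} (hlo : -N ≤ lo) (hhi : hi ≤ N) (lo0 : lo ≤ 0) (hi0 : 0 ≤ hi)
    (m1 : lo ≤ m) (m2 : m ≤ hi) (hmN : m.natAbs = N)
    (hm : ∀ i, lo ≤ i → i ≤ hi → i ≠ m → (3 * i + 1).natAbs < (3 * m + 1).natAbs)
    (v : ℕ → Pt) (hv : v 0 = zpt e1 e2 a b 0) (B : ℝ)
    (hB : ∀ i : ℤ, i = 1 ∨ i = -1 → v 1 = zpt e1 e2 a b i →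
      B ≤ ‖zpt e1 e2 a b i - zpt e1 e2 a b 0‖ + ‖zpt e1 e2 a b m - zpt e1 e2 a b i‖ +
        ‖0 - zpt e1 e2 a b m‖) :
    ((∃ m : ℕ, (∀ m' ≤ m, v m' ≠ 0) ∧
        ¬ TDAdj (Tri τ) ↑(zset e1 e2 a b lo hi) (v m) (v (m + 1))) ∨
      (∀ m : ℕ, v m ≠ 0) ∨
      (∀ M : ℕ, v M = 0 → (∀ m < M, v m ≠ 0) →
        B ≤ ∑ m ∈ Finset.range M, ‖v (m + 1) - v m‖)) := by
  by_cases hbad : ∃ m : ℕ, (∀ m' ≤ m, v m' ≠ 0) ∧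
        ¬ TDAdj (Tri τ) ↑(zset e1 e2 a b lo hi) (v m) (v (m + 1))
  · exact Or.inl hbad
  push Not at hbad
  refine Or.inr (Or.inr fun M hM hmin => ?_)
  have hz0 : zpt e1 e2 a b 0 ≠ 0 := by
    intro h
    have := congrArg fa h
    rw [fa_z F, map_zero] at this
    exact (Z.pos_a 0 (by omega) (by omega)).ne' this
  have hadj0 := hbad 0 (by intro m' h; rw [Nat.le_zero.1 h, hv]; exact hz0)
  rw [hv, zero_add] at hadj0
  have h1 : ∃ i : ℤ, (i = 1 ∨ i = -1) ∧ v 1 = zpt e1 e2 a b i := by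
    rcases mem_zset.1 hadj0.2.1 with h | ⟨i, i1, i2, h⟩
    · rw [h] at hadj0
      have := adj_zt F Z hlo hhi m1 m2 hm lo0 hi0 hadj0
      omega
    · rw [h] at hadj0
      have hz := (adj_zz F Z hlo hhi lo0 hi0 i1 i2).1 hadj0
      have h2 := zcond_level hz
      have h3 := hz.1
      exact ⟨i, by omega, h⟩
  obtain ⟨i, hi1, hvi⟩ := h1
  have hb := hB i hi1 hvi
  match M, hM, hmin with
  | 0, hM, _ => exact absurd (hv.symm.trans hM) hz0
  | 1, hM, _ =>
    rw [hM] at hadj0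
    have := adj_zt F Z hlo hhi m1 m2 hm lo0 hi0 hadj0
    omega
  | M + 2, hM, hmin =>
    have hadj := hbad (M + 1) (fun m' h => hmin m' (by omega))
    rw [show M + 1 + 1 = M + 2 from rfl, hM] at hadj
    have hvm : v (M + 1) = zpt e1 e2 a b m := by
      rcases mem_zset.1 hadj.1 with h | ⟨l, l1, l2, h⟩
      · exact absurd h (hmin (M + 1) (by omega))
      · rw [h] at hadj
        rw [h, adj_zt F Z hlo hhi m1 m2 hm l1 l2 hadj]
    have := sum_three v M
    rw [hvm, hM, hvi, hv] at this
    linarith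

lemma core (F : Frame τ e1 e2 fa fb) (a0 b0 : ℝ) (ha : 0 < a0) (hb : 0 < b0) (hab : a0 + b0 = 1)
    (k : ℕ) (A : Pt × Set (Pt × Pt) × Pt → Pt) (ρ : ℝ) (hρ : 0 < ρ) :
    ∃ S : Finset Pt, GenPos τ ↑S ∧ a0 • e1 + b0 • e2 ∈ S ∧ (0 : Pt) ∈ S ∧
      a0 • e1 + b0 • e2 ≠ 0 ∧
      ∀ v : ℕ → Pt, v 0 = a0 • e1 + b0 • e2 →
        (∀ m : ℕ, v (m + 1) = A (v m, Ek τ ↑S k (v m), 0)) →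
        ((∃ m : ℕ, (∀ m' ≤ m, v m' ≠ 0) ∧ ¬ TDAdj (Tri τ) ↑S (v m) (v (m + 1))) ∨
          (∀ m : ℕ, v m ≠ 0) ∨
          (∀ M : ℕ, v M = 0 → (∀ m < M, v m ≠ 0) →
            ‖e1 - e2‖ + min (‖a0 • e1 + b0 • e2 - e2‖ + ‖e1‖) (‖a0 • e1 + b0 • e2 - e1‖ + ‖e2‖)
              - ρ ≤ ∑ m ∈ Finset.range M, ‖v (m + 1) - v m‖)) := by
  have hL : 0 < ‖e1‖ + ‖e2‖ := by
    have : e1 ≠ 0 := by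
      intro h
      have := F.a1
      rw [h, map_zero] at this
      exact zero_ne_one this
    have := norm_pos_iff.2 this
    positivity
  obtain ⟨a, b, Z, az, bz, hp, hn⟩ := zchain_exists (k + 1) a0 b0 ha hb hab
    (ρ / 4 / (‖e1‖ + ‖e2‖)) (by positivity)
  have hs : zpt e1 e2 a b 0 = a0 • e1 + b0 • e2 := by rw [zpt, az, bz]
  have hs0 : zpt e1 e2 a b 0 ≠ 0 := by
    intro h
    have := congrArg fa h
    rw [fa_z F, map_zero, az] at this
    exact ha.ne' this
  have est : ∀ p q : ℝ, |p| ≤ ρ / 4 / (‖e1‖ + ‖e2‖) → |q| ≤ ρ / 4 / (‖e1‖ + ‖e2‖) →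
      ‖p • e1 + q • e2‖ ≤ ρ / 4 := by
    intro p q h1 h2
    calc _ ≤ |p| * ‖e1‖ + |q| * ‖e2‖ := by
          refine (norm_add_le _ _).trans ?_
          rw [norm_smul, norm_smul]; rfl
      _ ≤ ρ / 4 / (‖e1‖ + ‖e2‖) * ‖e1‖ + ρ / 4 / (‖e1‖ + ‖e2‖) * ‖e2‖ := by gcongr
      _ = ρ / 4 := by field_simp
  have hpz : ∀ i : ℤ, 0 < i → i ≤ (k + 1 : ℕ) → ‖zpt e1 e2 a b i - e1‖ ≤ ρ / 4 := by
    intro i h1 h2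
    have := est _ _ (hp i h1 h2).1 (hp i h1 h2).2
    rwa [show (a i - 1) • e1 + b i • e2 = zpt e1 e2 a b i - e1 by rw [zpt]; module] at this
  have hnz : ∀ i : ℤ, -(k + 1 : ℕ) ≤ i → i < 0 → ‖zpt e1 e2 a b i - e2‖ ≤ ρ / 4 := by
    intro i h1 h2
    have := est _ _ (hn i h1 h2).1 (hn i h1 h2).2
    rwa [show a i • e1 + (b i - 1) • e2 = zpt e1 e2 a b i - e2 by rw [zpt]; module] at this
  have tri : ∀ x y x' y' : Pt, ∀ r r' : ℝ, ‖x' - x‖ ≤ r → ‖y' - y‖ ≤ r' →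
      ‖x - y‖ - r - r' ≤ ‖x' - y'‖ := by
    intro x y x' y' r r' h1 h2
    have e : x - y = (x' - y') - (x' - x) + (y' - y) := by abel
    have := norm_add_le ((x' - y') - (x' - x)) (y' - y)
    have := norm_sub_le (x' - y') (x' - x)
    rw [← e] at *
    linarith
  have hE : Ek τ ↑(zset e1 e2 a b (-k) (k + 1)) k (zpt e1 e2 a b 0) =
      Ek τ ↑(zset e1 e2 a b (-(k + 1)) k) k (zpt e1 e2 a b 0) := by
    apply Set.Subset.antisymm
    · exact Ek_transfer F Z (m := k + 1) (by omega) (by omega) (by omega) (by omega) (by omega)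
        (by omega) (by omega) (by omega) (by omega) (by omega) (by omega) (by omega)
        (by intro i _ _ _; omega)
    · exact Ek_transfer F Z (m := -(k + 1)) (by omega) (by omega) (by omega) (by omega) (by omega)
        (by omega) (by omega) (by omega) (by omega) (by omega) (by omega) (by omega)
        (by intro i _ _ _; omega)
  rw [← hs]
  by_cases hw : A (zpt e1 e2 a b 0, Ek τ ↑(zset e1 e2 a b (-k) (k + 1)) k (zpt e1 e2 a b 0), 0) =
      zpt e1 e2 a b (-1)
  · refine ⟨zset e1 e2 a b (-k) (k + 1), zset_gen F Z (by omega) (by omega),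
      Finset.mem_coe.1 (mem_zset.2 (Or.inr ⟨0, by omega, by omega, rfl⟩)),
      Finset.mem_coe.1 (mem_zset.2 (Or.inl rfl)), hs0, ?_⟩
    intro v hv0 hv
    have hv1 : v 1 = zpt e1 e2 a b (-1) := by rw [← hw, ← hv0]; exact hv 0
    refine route F Z (m := k + 1) (by omega) (by omega) (by omega) (by omega) (by omega) (by omega)
      (by omega) (by omega) (by intro i _ _ _; omega) v hv0 _ ?_
    intro i _ hi
    rw [← hi, hv1]
    have h1 := tri e2 (zpt e1 e2 a b 0) _ (zpt e1 e2 a b 0) _ 0 (hnz (-1) (by omega) (by omega))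
      (by simp)
    have h2 := tri e1 e2 _ _ _ _ (hpz (k + 1) (by omega) (by omega))
      (hnz (-1) (by omega) (by omega))
    have h3 := tri 0 e1 0 _ 0 _ (by simp) (hpz (k + 1) (by omega) (by omega))
    rw [zero_sub e1, norm_neg] at h3
    rw [norm_sub_rev] at h1
    have := min_le_left (‖zpt e1 e2 a b 0 - e2‖ + ‖e1‖) (‖zpt e1 e2 a b 0 - e1‖ + ‖e2‖)
    linarith
  · refine ⟨zset e1 e2 a b (-(k + 1)) k, zset_gen F Z (by omega) (by omega),
      Finset.mem_coe.1 (mem_zset.2 (Or.inr ⟨0, by omega, by omega, rfl⟩)),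
      Finset.mem_coe.1 (mem_zset.2 (Or.inl rfl)), hs0, ?_⟩
    intro v hv0 hv
    have hv1 : v 1 ≠ zpt e1 e2 a b (-1) := by
      intro h
      apply hw
      rw [← h, hE, ← hv0]; exact (hv 0).symm
    refine route F Z (m := -(k + 1)) (by omega) (by omega) (by omega) (by omega) (by omega)
      (by omega) (by omega) (by omega) (by intro i _ _ _; omega) v hv0 _ ?_
    intro i hi1 hi
    obtain rfl : i = 1 := by
      rcases hi1 with h | h
      · exact h
      · rw [h] at hi; exact absurd hi hv1
    have h1 := tri e1 (zpt e1 e2 a b 0) _ (zpt e1 e2 a b 0) _ 0 (hpz 1 (by omega) (by omega))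
      (by simp)
    have h2 := tri e2 e1 _ _ _ _ (hnz (-(k + 1)) (by omega) (by omega))
      (hpz 1 (by omega) (by omega))
    have h3 := tri 0 e2 0 _ 0 _ (by simp) (hnz (-(k + 1)) (by omega) (by omega))
    rw [zero_sub e2, norm_neg] at h3
    rw [norm_sub_rev] at h1
    rw [norm_sub_rev e2 e1] at h2
    have := min_le_right (‖zpt e1 e2 a b 0 - e2‖ + ‖e1‖) (‖zpt e1 e2 a b 0 - e1‖ + ‖e2‖)
    linarith

end route

lemma trig_core (e1 e2 : Pt) (p q r α : ℝ) (hp : 0 < p) (hq : 0 < q) (hr : 0 < r)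
    (hsum : p + q + r = Real.pi) (h1 : Real.sin p * ‖e2‖ = Real.sin q * ‖e1 - e2‖)
    (h2 : Real.sin q * ‖e1‖ = Real.sin r * ‖e2‖)
    (hin : inner ℝ e1 e2 = ‖e1‖ * ‖e2‖ * Real.cos p) (he : e1 ≠ 0)
    (hα0 : 0 < α) (hαp : α < p) :
    ∃ a0 b0 : ℝ, 0 < a0 ∧ 0 < b0 ∧ a0 + b0 = 1 ∧
      (Real.sin (p - α) / Real.sin q + Real.sin α / Real.sin r +
        min (Real.sin α / Real.sin r + Real.sin (α + r) / Real.sin q)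
          (Real.sin (p - α) / Real.sin q + Real.sin (α + r) / Real.sin r)) *
        ‖a0 • e1 + b0 • e2‖ =
      ‖e1 - e2‖ + min (‖a0 • e1 + b0 • e2 - e2‖ + ‖e1‖) (‖a0 • e1 + b0 • e2 - e1‖ + ‖e2‖) := by
  have sp : 0 < Real.sin p := Real.sin_pos_of_pos_of_lt_pi hp (by linarith)
  have sq : 0 < Real.sin q := Real.sin_pos_of_pos_of_lt_pi hq (by linarith)
  have sr : 0 < Real.sin r := Real.sin_pos_of_pos_of_lt_pi hr (by linarith)
  have sα : 0 < Real.sin α := Real.sin_pos_of_pos_of_lt_pi hα0 (by linarith)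
  have sβ : 0 < Real.sin (p - α) := Real.sin_pos_of_pos_of_lt_pi (by linarith) (by linarith)
  have hL1 : 0 < ‖e1‖ := norm_pos_iff.2 he
  obtain ⟨D, hD⟩ : ∃ D, D = ‖e1‖ / Real.sin r := ⟨_, rfl⟩
  have hDpos : 0 < D := by rw [hD]; positivity
  have l1 : ‖e1‖ = D * Real.sin r := by rw [hD]; field_simp
  have l2 : ‖e2‖ = D * Real.sin q := by
    rw [l1] at h2
    have : Real.sin r * ‖e2‖ = Real.sin r * (D * Real.sin q) := by linarith
    exact mul_left_cancel₀ sr.ne' this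
  have l3 : ‖e1 - e2‖ = D * Real.sin p := by
    rw [l2] at h1
    have : Real.sin q * ‖e1 - e2‖ = Real.sin q * (D * Real.sin p) := by linarith
    exact mul_left_cancel₀ sq.ne' this
  have hid : Real.sin r * Real.sin (p - α) + Real.sin q * Real.sin α =
      Real.sin p * Real.sin (α + r) := by
    rw [show q = Real.pi - (p + r) by linarith, Real.sin_pi_sub, Real.sin_add, Real.sin_add,
      Real.sin_sub]
    ring
  obtain ⟨x, hx⟩ : ∃ x, x = Real.sin (p - α) / Real.sin q := ⟨_, rfl⟩
  obtain ⟨y, hy⟩ : ∃ y, y = Real.sin α / Real.sin r := ⟨_, rfl⟩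
  have xpos : 0 < x := by rw [hx]; positivity
  have ypos : 0 < y := by rw [hy]; positivity
  have hxs : x * Real.sin q = Real.sin (p - α) := by rw [hx]; field_simp
  have hys : y * Real.sin r = Real.sin α := by rw [hy]; field_simp
  have hnorm : ‖y • e1 + x • e2‖ = D * Real.sin p := by
    have hsq : ‖y • e1 + x • e2‖ ^ 2 = (D * Real.sin p) ^ 2 := by
      rw [norm_add_sq_real, norm_smul, norm_smul, inner_smul_left, inner_smul_right, hin, l1, l2,
        Real.norm_of_nonneg xpos.le, Real.norm_of_nonneg ypos.le]
      simp only [conj_trivial]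
      have : Real.sin α ^ 2 + 2 * (Real.sin α * Real.sin (p - α) * Real.cos p) +
          Real.sin (p - α) ^ 2 = Real.sin p ^ 2 := by
        rw [Real.sin_sub]
        have c1 := Real.sin_sq_add_cos_sq p
        have c2 := Real.sin_sq_add_cos_sq α
        have c1' : Real.cos p ^ 2 = 1 - Real.sin p ^ 2 := by linarith
        have c2' : Real.cos α ^ 2 = 1 - Real.sin α ^ 2 := by linarith
        ring_nf
        rw [c1', c2']
        ring
      calc _ = D ^ 2 * ((y * Real.sin r) ^ 2 + 2 * ((y * Real.sin r) * (x * Real.sin q) *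
            Real.cos p) + (x * Real.sin q) ^ 2) := by ring
        _ = _ := by rw [hxs, hys, this]; ring
    exact (sq_eq_sq₀ (norm_nonneg _) (by positivity)).1 hsq
  have hxy : 0 < x + y := by positivity
  refine ⟨y / (x + y), x / (x + y), by positivity, by positivity, by field_simp; ring, ?_⟩
  have n0 : ‖(y / (x + y)) • e1 + (x / (x + y)) • e2‖ = D * Real.sin p / (x + y) := by
    rw [show (y / (x + y)) • e1 + (x / (x + y)) • e2 = (x + y)⁻¹ • (y • e1 + x • e2) by
      rw [smul_add, smul_smul, smul_smul]; congr 2 <;> field_simp, norm_smul, hnorm,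
      Real.norm_of_nonneg (by positivity)]
    field_simp
  have n2 : ‖(y / (x + y)) • e1 + (x / (x + y)) • e2 - e2‖ = y * (D * Real.sin p / (x + y)) := by
    rw [show (y / (x + y)) • e1 + (x / (x + y)) • e2 - e2 = (y / (x + y)) • (e1 - e2) by
      rw [show x / (x + y) = 1 - y / (x + y) by field_simp; ring]; module, norm_smul, l3,
      Real.norm_of_nonneg (by positivity)]
    field_simp
  have n1 : ‖(y / (x + y)) • e1 + (x / (x + y)) • e2 - e1‖ = x * (D * Real.sin p / (x + y)) := by
    rw [show (y / (x + y)) • e1 + (x / (x + y)) • e2 - e1 = (x / (x + y)) • (e2 - e1) by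
      rw [show y / (x + y) = 1 - x / (x + y) by field_simp; ring]; module, norm_smul,
      norm_sub_rev, l3, Real.norm_of_nonneg (by positivity)]
    field_simp
  have hsin : Real.sin (α + r) = Real.sin r * Real.sin q * (x + y) / Real.sin p := by
    rw [eq_div_iff sp.ne']
    linear_combination -hid - Real.sin r * hxs - Real.sin q * hys
  rw [n0, n1, n2, l1, l2, l3, ← hx, ← hy, add_mul, min_mul_of_nonneg _ _ (by positivity), hsin]
  congr 1
  · field_simp
  · congr 1 <;> field_simp

/-- Every deterministic memoryless `k`-local routing algorithm `A` on
`TD_{θ₁,θ₂}`-Delaunay graphs has routing ratio at least `C(θ₁,θ₂) − ε` on some instance: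
either the walk produced by `A` takes an invalid (non-adjacent) step before reaching `t`,
or it never reaches `t`, or the walk up to the first visit of `t` has length at least
`(C(θ₁,θ₂) − ε)·‖s − t‖`. -/
theorem k_local_routing_lower_bound
    (θ : Fin 3 → ℝ) (hθ0 : 0 < θ 0) (hθ01 : θ 0 ≤ θ 1) (hθ12 : θ 1 ≤ θ 2)
    (hsum : θ 0 + θ 1 + θ 2 = Real.pi)
    (τ : Fin 3 → Pt) (hncol : ¬ Collinear ℝ (Set.range τ))
    (hangle : ∀ j : Fin 3, EuclideanGeometry.angle (τ (j + 1)) (τ j) (τ (j - 1)) = θ j)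
    (k : ℕ) (hk : 0 < k)
    (A : Pt × Set (Pt × Pt) × Pt → Pt)
    (ε : ℝ) (hε : 0 < ε) :
    ∃ S : Finset Pt, GenPos τ ↑S ∧ ∃ s ∈ S, ∃ t ∈ S, s ≠ t ∧
      ∀ v : ℕ → Pt, v 0 = s →
        (∀ m : ℕ, v (m + 1) = A (v m,
            { e : Pt × Pt | TDAdj (Tri τ) ↑S e.1 e.2 ∧
              e.1 ∈ ReachK (TDAdj (Tri τ) ↑S) k (v m) ∧
              e.2 ∈ ReachK (TDAdj (Tri τ) ↑S) k (v m) }, t)) →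
        ((∃ m : ℕ, (∀ m' ≤ m, v m' ≠ t) ∧ ¬ TDAdj (Tri τ) ↑S (v m) (v (m + 1))) ∨
          (∀ m : ℕ, v m ≠ t) ∨
          (∀ M : ℕ, v M = t → (∀ m < M, v m ≠ t) →
            (Cval θ - ε) * ‖s - t‖ ≤ ∑ m ∈ Finset.range M, ‖v (m + 1) - v m‖)) := by
  obtain ⟨j, α, hα, hC⟩ : ∃ j : Fin 3, ∃ α : ℝ, α ∈ Set.Ioo 0 (θ j) ∧
      Cval θ - ε / 2 < Cexpr θ j α := by
    have hpos : ∀ j : Fin 3, 0 < θ j := by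
      intro j; fin_cases j
      · exact hθ0
      · exact lt_of_lt_of_le hθ0 hθ01
      · exact lt_of_lt_of_le hθ0 (hθ01.trans hθ12)
    obtain ⟨_, ⟨j, α, hα, rfl⟩, h⟩ := exists_lt_of_lt_csSup
      (s := { x : ℝ | ∃ j : Fin 3, ∃ α : ℝ, α ∈ Set.Icc 0 (θ j) ∧ x = Cexpr θ j α })
      ⟨_, 0, 0, ⟨le_refl _, (hpos 0).le⟩, rfl⟩ (show Cval θ - ε / 2 < Cval θ by linarith)
    have hcont : Continuous (Cexpr θ j) := by
      unfold Cexpr; fun_prop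
    rw [← closure_Ioo (hpos j).ne] at hα
    obtain ⟨β, hβ1, hβ2⟩ := mem_closure_iff.1 hα {β | Cval θ - ε / 2 < Cexpr θ j β}
      (isOpen_lt continuous_const hcont) h
    exact ⟨j, β, hβ2, hβ1⟩
  have hpos : ∀ j : Fin 3, 0 < θ j := by
    intro j; fin_cases j
    · exact hθ0
    · exact lt_of_lt_of_le hθ0 hθ01
    · exact lt_of_lt_of_le hθ0 (hθ01.trans hθ12)
  have hsum' : θ j + θ (j + 1) + θ (j - 1) = Real.pi := by
    rw [← hsum]
    fin_cases j
    · rfl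
    · change θ 1 + θ 2 + θ 0 = _; ring
    · change θ 2 + θ 0 + θ 1 = _; ring
  have f1 : j + 1 + 1 = j - 1 := by clear * -; revert j; decide
  have f2 : j - 1 + 1 = j := by clear * -; revert j; decide
  have f3 : j + 1 - 1 = j := by clear * -; revert j; decide
  have f4 : j - 1 - 1 = j + 1 := by clear * -; revert j; decide
  have g0 := hangle j
  have g1 := hangle (j + 1)
  have g2 := hangle (j - 1)
  rw [f1, f3] at g1
  rw [f2, f4] at g2
  have s1 := EuclideanGeometry.law_sin (τ (j + 1)) (τ j) (τ (j - 1))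
  have s2 := EuclideanGeometry.law_sin (τ (j - 1)) (τ (j + 1)) (τ j)
  rw [g0, g1, dist_eq_norm', dist_eq_norm'] at s1
  rw [g1, g2, dist_eq_norm, dist_eq_norm'] at s2
  obtain ⟨fa, fb, F⟩ := frame_exists τ hncol j
  have he : τ (j + 1) - τ j ≠ 0 := by
    intro h
    have := F.a1
    rw [h, map_zero] at this
    exact zero_ne_one this
  have hin : inner ℝ (τ (j + 1) - τ j) (τ (j - 1) - τ j) =
      ‖τ (j + 1) - τ j‖ * ‖τ (j - 1) - τ j‖ * Real.cos (θ j) := by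
    rw [← g0, EuclideanGeometry.angle, vsub_eq_sub, vsub_eq_sub, mul_comm,
      InnerProductGeometry.cos_angle_mul_norm_mul_norm]
  obtain ⟨a0, b0, ha, hb, hab, hval⟩ := trig_core (τ (j + 1) - τ j) (τ (j - 1) - τ j) (θ j)
    (θ (j + 1)) (θ (j - 1)) α (hpos _) (hpos _) (hpos _) hsum'
    (by rw [s1]; congr 2; abel) s2 hin he hα.1 hα.2
  change Cexpr θ j α * _ = _ at hval
  set s := a0 • (τ (j + 1) - τ j) + b0 • (τ (j - 1) - τ j) with hs
  have hs0 : 0 < ‖s‖ := by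
    rw [norm_pos_iff]
    intro h
    have := congrArg fa h
    rw [hs, map_add, map_smul, map_smul, F.a1, F.a2, map_zero] at this
    simp at this
    exact ha.ne' this
  obtain ⟨S, hS, hsS, htS, hst, hroute⟩ := core F a0 b0 ha hb hab k A (ε / 2 * ‖s‖)
    (by positivity)
  refine ⟨S, hS, s, hsS, 0, htS, hst, fun v hv0 hv => ?_⟩
  rcases hroute v hv0 hv with h | h | h
  · exact Or.inl h
  · exact Or.inr (Or.inl h)
  · refine Or.inr (Or.inr fun M h1 h2 => le_trans ?_ (h M h1 h2))
    rw [← hs, ← hval, sub_zero]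
    nlinarith
end
end
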